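/- arXiv:2402.03198 — 4 statements merged into one kernel-verified Lean document; each statement's English description precedes it below -/
import Mathlib

section
/- Let V be a finite set and let (V_0, …, V_m) and (V'_0, …, V'_m) be two ordered partitions of V into m+1 nonempty parts whose underlying unordered partitions are different (the families {V_j} and {V'_j} are not equal). Fix θ ∈ ℝ^V with θ_i > 0 for all i and ∑_{i∈V'_j} θ_i = 1 for every j. For ρ' = (ρ'_0, …, ρ'_m) with all ρ'_j > 0, define λ_i = ρ'_{j'}·θ_i for i ∈ V'_{j'}, ρ_j = ∑_{i∈V_j} λ_i, and g(ρ') = (∏_{j=0}^{m} (ρ'_j)^{|V'_j|}) / (∏_{j=0}^{m} ρ_j^{|V_j|}). Then the iterated limit lim_{ρ'_1→0⁺} ( ⋯ ( lim_{ρ'_m→0⁺} g(ρ') ) ⋯ ) equals 0; that is, the innermost limit is taken in ρ'_m with all other variables fixed and positive, each successive limit exists, and the final value is 0 for every choice of the remaining positive variable ρ'_0. -/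
open Finset Filter


lemma s7_g {V : Type*} [Fintype V] {n : ℕ} (idx idx' : V → Fin n) (a b : Fin n → ℝ) :
    (∏ j, (a j) ^ (Finset.univ.filter (fun i => idx' i = j)).card) /
      (∏ j, (b j) ^ (Finset.univ.filter (fun i => idx i = j)).card)
    = ∏ i, (a (idx' i) / b (idx i)) := by
  have key : ∀ (f : V → Fin n) (c : Fin n → ℝ),
      (∏ j, (c j) ^ (Finset.univ.filter (fun i => f i = j)).card) = ∏ i, c (f i) := by
    intro f c
    rw [← Finset.prod_fiberwise (s := Finset.univ) (g := f) (f := fun i => c (f i))]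
    refine Finset.prod_congr rfl fun j _ => ?_
    rw [← Finset.prod_const]
    refine Finset.prod_congr rfl fun i hi => ?_
    rw [(Finset.mem_filter.1 hi).2]
  rw [key, key, Finset.prod_div_distrib]

/-- the radial sum -/
noncomputable def s7R {V : Type*} [Fintype V] {n : ℕ} (idx idx' : V → Fin n) (θ : V → ℝ)
    (ρ : Fin n → ℝ) (j : Fin n) : ℝ :=
  ∑ i ∈ Finset.univ.filter (fun i => idx i = j), ρ (idx' i) * θ i

lemma s7R_pos {V : Type*} [Fintype V] {n : ℕ} (idx idx' : V → Fin n) (θ : V → ℝ)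
    (hθ : ∀ i, 0 < θ i) (ρ : Fin n → ℝ) (hρ : ∀ j, 0 ≤ ρ j) (i : V) (hi : 0 < ρ (idx' i)) :
    0 < s7R idx idx' θ ρ (idx i) := by
  unfold s7R
  refine Finset.sum_pos' (fun l _ => mul_nonneg (hρ _) (hθ l).le) ⟨i, by simp, mul_pos hi (hθ i)⟩

lemma s7R_out {V : Type*} [Fintype V] {n : ℕ} (idx idx' : V → Fin n) (θ : V → ℝ)
    (ρ : Fin n → ℝ) (k j : Fin n) (t : ℝ) (h : ∀ l, idx l = j → idx' l ≠ k) :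
    s7R idx idx' θ (Function.update ρ k t) j = s7R idx idx' θ ρ j := by
  unfold s7R
  refine Finset.sum_congr rfl fun l hl => ?_
  rw [Function.update_of_ne (h l (Finset.mem_filter.1 hl).2)]

lemma s7R_in {V : Type*} [Fintype V] {n : ℕ} (idx idx' : V → Fin n) (θ : V → ℝ)
    (ρ : Fin n → ℝ) (k j : Fin n) (t : ℝ) (hk : 0 < ρ k) (h : ∀ l, idx l = j → idx' l = k) :
    s7R idx idx' θ (Function.update ρ k t) j = t / ρ k * s7R idx idx' θ ρ j := by
  unfold s7R
  rw [Finset.mul_sum]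
  refine Finset.sum_congr rfl fun l hl => ?_
  rw [h l (Finset.mem_filter.1 hl).2, Function.update_self]
  field_simp

lemma s7R_ratio_in {V : Type*} [Fintype V] {n : ℕ} (idx idx' : V → Fin n) (θ : V → ℝ)
    (ρ : Fin n → ℝ) (k : Fin n) (i : V) (t : ℝ) (hk : 0 < ρ k) (ht : 0 < t)
    (hi : idx' i = k) (h : ∀ l, idx l = idx i → idx' l = k) :
    (Function.update ρ k t) (idx' i) / s7R idx idx' θ (Function.update ρ k t) (idx i)
      = ρ (idx' i) / s7R idx idx' θ ρ (idx i) := by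
  rw [s7R_in idx idx' θ ρ k _ t hk h, hi, Function.update_self]
  rw [div_mul_eq_mul_div, div_div_eq_mul_div, mul_div_mul_left _ _ ht.ne']

lemma s7_sat {V : Type*} [Fintype V] {n : ℕ} (idx idx' : V → Fin n) (θ : V → ℝ)
    (ρ : Fin n → ℝ) (hρ : ∀ j, 0 < ρ j) (k : Fin n)
    (hs : ∀ i i', idx i = idx i' → idx' i = k → idx' i' = k) (t : ℝ) (ht : 0 < t) :
    ∏ i, ((Function.update ρ k t) (idx' i) / s7R idx idx' θ (Function.update ρ k t) (idx i))
      = ∏ i, (ρ (idx' i) / s7R idx idx' θ ρ (idx i)) := by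
  refine Finset.prod_congr rfl fun i _ => ?_
  by_cases hi : idx' i = k
  · exact s7R_ratio_in idx idx' θ ρ k i t (hρ k) ht hi (fun l hl => hs i l hl.symm hi)
  · rw [s7R_out idx idx' θ ρ k _ t (fun l hl h => hi (hs l i hl h)), Function.update_of_ne hi]

lemma s7_lim {V : Type*} [Fintype V] {n : ℕ} (idx idx' : V → Fin n) (θ : V → ℝ)
    (hθ : ∀ i, 0 < θ i)
    (ρ : Fin n → ℝ) (hρ : ∀ j, 0 < ρ j) (k : Fin n)
    (hs : ¬ ∀ i i', idx i = idx i' → idx' i = k → idx' i' = k) :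
    Tendsto (fun t : ℝ => ∏ i, ((Function.update ρ k t) (idx' i) /
        s7R idx idx' θ (Function.update ρ k t) (idx i)))
      (nhdsWithin 0 (Set.Ioi 0)) (nhds 0) := by
  -- factors with a fibre not contained in the part converge by continuity
  have hcont : ∀ i l, idx l = idx i → idx' l ≠ k →
      Tendsto (fun t : ℝ => (Function.update ρ k t) (idx' i) /
        s7R idx idx' θ (Function.update ρ k t) (idx i)) (nhdsWithin 0 (Set.Ioi 0))
        (nhds ((Function.update ρ k 0) (idx' i) /
          s7R idx idx' θ (Function.update ρ k 0) (idx i))) := by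
    intro i l hl hlk
    have hu : ∀ q, Continuous (fun t : ℝ => (Function.update ρ k t) q) := fun q =>
      (continuous_apply q).comp ((continuous_const (y := ρ)).update k continuous_id)
    have hR : Continuous (fun t : ℝ => s7R idx idx' θ (Function.update ρ k t) (idx i)) := by
      unfold s7R
      exact continuous_finsetSum _ fun q _ => (hu _).mul continuous_const
    have hpos : 0 < s7R idx idx' θ (Function.update ρ k 0) (idx i) := by
      rw [← hl]
      refine s7R_pos idx idx' θ hθ _ (fun j => ?_) l ?_
      · by_cases hj : j = k
        · subst hj; simp
        · rw [Function.update_of_ne hj]; exact (hρ j).le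
      · rw [Function.update_of_ne hlk]; exact hρ _
    exact (((hu _).tendsto 0).div (hR.tendsto 0) hpos.ne').mono_left nhdsWithin_le_nhds
  have hall : ∀ i, ∃ a, Tendsto (fun t : ℝ => (Function.update ρ k t) (idx' i) /
        s7R idx idx' θ (Function.update ρ k t) (idx i)) (nhdsWithin 0 (Set.Ioi 0)) (nhds a) ∧
        ((idx' i = k ∧ ∃ l, idx l = idx i ∧ idx' l ≠ k) → a = 0) := by
    intro i
    by_cases h : ∃ l, idx l = idx i ∧ idx' l ≠ k
    · obtain ⟨l, hl, hlk⟩ := h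
      refine ⟨_, hcont i l hl hlk, fun h => ?_⟩
      rw [h.1, Function.update_self, zero_div]
    · refine ⟨ρ (idx' i) / s7R idx idx' θ ρ (idx i), ?_, fun h' => absurd h'.2 h⟩
      push Not at h
      refine tendsto_const_nhds.congr' ?_
      filter_upwards [self_mem_nhdsWithin] with t ht
      exact (s7R_ratio_in idx idx' θ ρ k i t (hρ k) ht (h i rfl) h).symm
  choose a ha ha0 using hall
  push Not at hs
  obtain ⟨i, l, hil, hi, hl⟩ := hs
  have : ∏ i, a i = 0 := Finset.prod_eq_zero (Finset.mem_univ i) (ha0 i ⟨hi, l, hil.symm, hl⟩)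
  have hfin := tendsto_finsetProd Finset.univ fun i _ => ha i
  rwa [this] at hfin

/-- Two ordered partitions of `V` into `m+1` nonempty parts with
*different* underlying unordered partitions are encoded by surjective
`idx, idx' : V → Fin (m+1)`.  Fix angular coordinates `θ` (positive, summing to `1` on
each primed part).  With `λ_i = ρ'_{idx' i}·θ_i`, `ρ_j = ∑_{idx i = j} λ_i`, and
`g(ρ') = ∏_j (ρ'_j)^{|V'_j|} / ∏_j ρ_j^{|V_j|}`, the iterated limit
`lim_{ρ'_1→0⁺} (⋯ (lim_{ρ'_m→0⁺} g(ρ')) ⋯)` exists at each stage and equals `0`: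
there is a tower `L` of functions with `L m = g`, each `L (j-1)` the one-sided limit of
`L j` in the variable `ρ'_j` (at every positive point), and `L 0 = 0` on the positive
orthant (in particular for every choice of the remaining positive variable `ρ'_0`). -/
theorem statement7 {V : Type*} [Fintype V] [DecidableEq V] (m : ℕ)
    (idx idx' : V → Fin (m + 1))
    (hidx : Function.Surjective idx) (hidx' : Function.Surjective idx')
    (hdiff : ¬ ∃ σ : Equiv.Perm (Fin (m + 1)), ∀ i, idx' i = σ (idx i))
    (θ : V → ℝ) (hθpos : ∀ i, 0 < θ i)
    (hθsum : ∀ j, ∑ i ∈ Finset.univ.filter (fun i => idx' i = j), θ i = 1)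
    (g : (Fin (m + 1) → ℝ) → ℝ)
    (hg : ∀ ρ' : Fin (m + 1) → ℝ,
      g ρ' = (∏ j, (ρ' j) ^ (Finset.univ.filter (fun i => idx' i = j)).card) /
             (∏ j, (∑ i ∈ Finset.univ.filter (fun i => idx i = j), ρ' (idx' i) * θ i) ^
               (Finset.univ.filter (fun i => idx i = j)).card)) :
    ∃ L : ℕ → (Fin (m + 1) → ℝ) → ℝ,
      L m = g ∧
      (∀ (j : ℕ) (hj1 : 1 ≤ j) (hj2 : j ≤ m), ∀ ρ' : Fin (m + 1) → ℝ,
        (∀ j', 0 < ρ' j') →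
        Tendsto (fun t : ℝ => L j (Function.update ρ' ⟨j, by omega⟩ t))
          (nhdsWithin 0 (Set.Ioi 0)) (nhds (L (j - 1) ρ'))) ∧
      (∀ ρ' : Fin (m + 1) → ℝ, (∀ j', 0 < ρ' j') → L 0 ρ' = 0) := by
  classical
  have hg' : ∀ ρ, g ρ = ∏ i, (ρ (idx' i) / s7R idx idx' θ ρ (idx i)) := fun ρ => by
    rw [hg ρ]; exact s7_g idx idx' ρ (s7R idx idx' θ ρ)
  let S : Fin (m + 1) → Prop := fun k => ∀ i i', idx i = idx i' → idx' i = k → idx' i' = k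
  refine ⟨fun k ρ => if ∀ k' : Fin (m + 1), k < k'.val → S k' then g ρ else 0, ?_, ?_, ?_⟩
  · funext ρ
    exact if_pos fun k' hk' => absurd k'.isLt (by omega)
  · intro j hj1 hj2 ρ hρ
    by_cases hj : ∀ k' : Fin (m + 1), j < k'.val → S k'
    · simp only [if_pos hj]
      by_cases hS : S ⟨j, by omega⟩
      · have h2 : ∀ k' : Fin (m + 1), j - 1 < k'.val → S k' := by
          intro k' hk'
          by_cases h : j < k'.val
          · exact hj k' h
          · have : k' = ⟨j, by omega⟩ := Fin.ext (by simp only; omega)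
            rw [this]; exact hS
        rw [if_pos h2]
        refine tendsto_const_nhds.congr' ?_
        filter_upwards [self_mem_nhdsWithin] with t ht
        rw [hg', hg']
        exact (s7_sat idx idx' θ ρ hρ _ hS t ht).symm
      · rw [if_neg (fun h => hS (h ⟨j, by omega⟩ (by simp only; omega)))]
        simp only [hg']
        exact s7_lim idx idx' θ hθpos ρ hρ _ hS
    · simp only [if_neg hj]
      rw [if_neg (fun h => hj fun k' hk' => h k' (by omega))]
      exact tendsto_const_nhds
  · intro ρ hρ
    refine if_neg fun h => hdiff ?_
    have hc : ∀ i i', idx i = idx i' → idx' i = idx' i' := by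
      intro i i' hii
      by_cases h1 : 0 < (idx' i).val
      · exact (h _ h1 i i' hii rfl).symm
      · by_cases h2 : 0 < (idx' i').val
        · exact h _ h2 i' i hii.symm rfl
        · exact Fin.ext (by omega)
    choose s hs using hidx
    have hfs : ∀ i, idx' (s (idx i)) = idx' i := fun i => hc _ _ (hs _)
    have hsurj : Function.Surjective (fun j => idx' (s j)) := fun k => by
      obtain ⟨i, hi⟩ := hidx' k
      exact ⟨idx i, (hfs i).trans hi⟩
    exact ⟨Equiv.ofBijective _ (Finite.injective_iff_bijective.1
      (Finite.injective_iff_surjective.2 hsurj)), fun i => (hfs i).symm⟩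
end

section
/- Let m ≥ 0, let n_0, …, n_m be nonnegative integers, set n = m + ∑_{j=0}^{m} n_j, and let ρ_0, …, ρ_m > 0. Let t_0, …, t_m be independent random variables, with t_j Gamma-distributed with shape n_j + 1 and rate ρ_j. Then P(t_0 ≤ t_1 ≤ ⋯ ≤ t_m) = (n!/∏_{j=0}^{m} n_j!) · ∫_D ∏_{j=0}^{m} r_j^{n_j} dr_1 ⋯ dr_m, where D = {(r_1, …, r_m) ∈ ℝ^m : r_j ≥ 0 for all j, ∑_{j=1}^{m} r_j ≤ 1, and, setting r_0 = 1 − ∑_{j=1}^{m} r_j, one has ρ_j · r_{j−1} ≤ ρ_{j−1} · r_j for j = 1, …, m}. -/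
open MeasureTheory ProbabilityTheory Nat
open scoped ENNReal

lemma aux_cons (m : ℕ) (F : (Fin (m+1) → ℝ) → ℝ≥0∞) (hF : Measurable F) :
    ∫⁻ x, F x = ∫⁻ a : ℝ, ∫⁻ y : Fin m → ℝ, F (Fin.cons a y) := by
  have h := (volume_preserving_piFinSuccAbove (fun _ : Fin (m+1) => ℝ) 0).symm
  rw [← h.lintegral_comp hF, Measure.volume_eq_prod, lintegral_prod]
  · simp [Fin.insertNthEquiv]
  · exact (hF.comp (MeasurableEquiv.measurable _)).aemeasurable

lemma aux_prod (m : ℕ) (f : Fin m → ℝ → ℝ≥0∞) (hf : ∀ i, Measurable (f i)) :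
    ∫⁻ x : Fin m → ℝ, ∏ i, f i (x i) = ∏ i, ∫⁻ a, f i a := by
  induction m with
  | zero => simp [volume_pi, Measure.pi_empty_univ]
  | succ m ih =>
    rw [aux_cons _ _ (by fun_prop), Fin.prod_univ_succ, ← ih _ (fun i => hf _)]
    simp_rw [Fin.prod_univ_succ, Fin.cons_zero, Fin.cons_succ]
    rw [← lintegral_mul_const _ (hf 0)]
    congr with a
    rw [lintegral_const_mul]
    fun_prop

lemma aux_pi (m : ℕ) (f : Fin m → ℝ → ℝ≥0∞) (hf : ∀ i, Measurable (f i))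
    [∀ i, SigmaFinite (volume.withDensity (f i))] :
    Measure.pi (fun i => volume.withDensity (f i))
      = volume.withDensity (fun x : Fin m → ℝ => ∏ i, f i (x i)) := by
  refine Measure.pi_eq fun s hs => ?_
  rw [withDensity_apply _ (MeasurableSet.univ_pi hs), ← lintegral_indicator (MeasurableSet.univ_pi hs)]
  have : ∀ i, (volume.withDensity (f i)) (s i) = ∫⁻ a, (s i).indicator (f i) a := fun i => by
    rw [withDensity_apply _ (hs i), lintegral_indicator (hs i)]
  simp_rw [this]
  rw [← aux_prod _ _ (fun i => (hf i).indicator (hs i))]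
  congr with x
  classical
  by_cases hx : x ∈ Set.univ.pi s
  · rw [Set.indicator_of_mem hx]
    refine Finset.prod_congr rfl fun i _ => ?_
    rw [Set.indicator_of_mem (hx i trivial)]
  · rw [Set.indicator_of_notMem hx]
    simp only [Set.mem_pi, not_forall] at hx
    obtain ⟨i, -, hi⟩ := hx
    exact (Finset.prod_eq_zero (Finset.mem_univ i) (Set.indicator_of_notMem hi _)).symm

lemma aux_scale (m : ℕ) (s : ℝ) (hs : 0 < s) (G : (Fin m → ℝ) → ℝ≥0∞) (hG : Measurable G) :
    ∫⁻ y, G y = ENNReal.ofReal (s^m) * ∫⁻ r, G (s • r) := by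
  have h := Measure.map_addHaar_smul (volume : Measure (Fin m → ℝ)) hs.ne'
  have h2 : ∫⁻ r, G (s • r) = ∫⁻ r, G r ∂(Measure.map (s • ·) volume) := by
    rw [lintegral_map hG (by fun_prop)]
  rw [h2, h, lintegral_smul_measure, smul_eq_mul, ← mul_assoc, ← ENNReal.ofReal_mul (by positivity),
    abs_of_pos (by positivity)]
  simp [hs.ne']

lemma aux_polar (m : ℕ) (F : (Fin (m+1) → ℝ) → ℝ≥0∞) (hF : Measurable F)
    (h0 : ∀ x, ∀ j, x j < 0 → F x = 0) :
    ∫⁻ x, F x = ∫⁻ s in Set.Ioi (0:ℝ), ENNReal.ofReal (s^m) *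
      ∫⁻ r : Fin m → ℝ, F (s • (Fin.cons (1 - ∑ j, r j) r : Fin (m+1) → ℝ)) := by
  have hc : Measurable (fun p : ℝ × (Fin m → ℝ) => (Fin.cons p.1 p.2 : Fin (m+1) → ℝ)) := by
    rw [measurable_pi_iff]
    intro i
    refine Fin.cases ?_ (fun i => ?_) i
    · simpa using measurable_fst
    · simp only [Fin.cons_succ]; fun_prop
  have hm : Measurable (fun p : ℝ × (Fin m → ℝ) => F (Fin.cons (p.1 - ∑ j, p.2 j) p.2)) :=
    hF.comp (hc.comp (f := fun p : ℝ × (Fin m → ℝ) => (p.1 - ∑ j, p.2 j, p.2)) (by fun_prop))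
  have hms : ∀ s : ℝ, Measurable (fun y : Fin m → ℝ => F (Fin.cons (s - ∑ j, y j) y)) := fun s =>
    hm.comp measurable_prodMk_left
  rw [aux_cons _ _ hF, lintegral_lintegral_swap (f := fun a y => F (Fin.cons a y))
    (hF.comp hc).aemeasurable]
  have : ∀ y : Fin m → ℝ, ∫⁻ a : ℝ, F (Fin.cons a y) = ∫⁻ s : ℝ, F (Fin.cons (s - ∑ j, y j) y) :=
    fun y => (lintegral_sub_right_eq_self (fun a : ℝ => F (Fin.cons a y)) (∑ j, y j)).symm
  rw [lintegral_congr this]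
  have hswap := lintegral_lintegral_swap (μ := (volume : Measure ℝ))
    (ν := (volume : Measure (Fin m → ℝ)))
    (f := fun s y => F (Fin.cons (s - ∑ j, y j) y)) hm.aemeasurable
  refine hswap.symm.trans ?_
  rw [← lintegral_indicator measurableSet_Ioi]
  have hne : ∀ᵐ s : ℝ, s ≠ 0 := Measure.ae_ne volume 0
  refine lintegral_congr_ae ?_
  filter_upwards [hne] with s hs
  rcases lt_or_gt_of_ne hs with hs | hs
  · rw [Set.indicator_of_notMem (by simpa using hs.le)]
    rw [lintegral_eq_zero_iff (hms s)]
    refine Filter.Eventually.of_forall fun y => ?_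
    by_contra hne
    have hpos : ∀ j, 0 ≤ (Fin.cons (s - ∑ j, y j) y : Fin (m+1) → ℝ) j := by
      intro j
      by_contra hj
      exact hne (h0 _ j (not_le.mp hj))
    have h1 := hpos 0
    have h2 : 0 ≤ ∑ j, y j := Finset.sum_nonneg fun j _ => by simpa using hpos j.succ
    simp only [Fin.cons_zero] at h1
    linarith
  · rw [Set.indicator_of_mem (by simpa using hs)]
    rw [aux_scale m s hs _ (hms s)]
    refine congrArg _ (lintegral_congr fun r => ?_)
    refine congrArg F ?_
    ext i
    refine Fin.cases ?_ (fun i => ?_) i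
    · simp [mul_sub, Finset.mul_sum]
    · simp

lemma aux_gamma (N : ℕ) :
    ∫⁻ s in Set.Ioi (0:ℝ), ENNReal.ofReal (s^N * Real.exp (-s)) = (N ! : ℝ≥0∞) := by
  have h1 : (0:ℝ) < N + 1 := by positivity
  have hi := Real.GammaIntegral_convergent h1
  have he := Real.Gamma_eq_integral h1
  rw [Real.Gamma_nat_eq_factorial] at he
  have : ∀ s : ℝ, Real.exp (-s) * s ^ ((N:ℝ) + 1 - 1) = s^N * Real.exp (-s) := fun s => by
    rw [add_sub_cancel_right, Real.rpow_natCast, mul_comm]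
  simp_rw [this] at hi he
  rw [← ofReal_integral_eq_lintegral_ofReal hi, ← he]
  · simp
  · filter_upwards [self_mem_ae_restrict measurableSet_Ioi] with s hs
    have : (0:ℝ) < s := hs
    simp only [Pi.zero_apply]; positivity

lemma aux_diag (m : ℕ) (ρ : Fin m → ℝ) (hρ : ∀ j, 0 < ρ j) (G : (Fin m → ℝ) → ℝ≥0∞)
    (hG : Measurable G) :
    ∫⁻ t, G t = ENNReal.ofReal (∏ j, (ρ j)⁻¹) * ∫⁻ x : Fin m → ℝ, G (fun j => (ρ j)⁻¹ * x j) := by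
  have hp : 0 < ∏ j, (ρ j)⁻¹ := Finset.prod_pos fun j _ => inv_pos.2 (hρ j)
  have h := Real.smul_map_diagonal_volume_pi (D := fun j => (ρ j)⁻¹)
    (by rw [Matrix.det_diagonal]; exact hp.ne')
  conv_lhs => rw [← h]
  rw [lintegral_smul_measure, smul_eq_mul, Matrix.det_diagonal, abs_of_pos hp,
    lintegral_map hG (LinearMap.continuous_of_finiteDimensional _).measurable]
  congr 2 with x
  congr 1
  ext j
  rw [Matrix.toLin'_apply, Matrix.mulVec_diagonal]

lemma aux_pdf (n : ℕ) (ρ x : ℝ) (hρ : 0 < ρ) :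
    ENNReal.ofReal ρ⁻¹ * gammaPDF ((n : ℝ) + 1) ρ (ρ⁻¹ * x)
      = ENNReal.ofReal (if 0 ≤ x then x ^ n * Real.exp (-x) / (n ! : ℝ) else 0) := by
  rw [gammaPDF_eq, ← ENNReal.ofReal_mul (by positivity)]
  congr 1
  have : 0 ≤ ρ⁻¹ * x ↔ 0 ≤ x := mul_nonneg_iff_of_pos_left (inv_pos.2 hρ)
  simp only [this]
  split_ifs with h
  · rw [add_sub_cancel_right, Real.Gamma_nat_eq_factorial, Real.rpow_natCast,
      Real.rpow_add hρ, Real.rpow_natCast, Real.rpow_one, mul_pow, ← mul_assoc ρ ρ⁻¹ x,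
      mul_inv_cancel₀ hρ.ne', one_mul, inv_pow]
    field_simp
  · simp

lemma aux_meas (m : ℕ) : Measurable
    (fun r : Fin m → ℝ => (Fin.cons (1 - ∑ j, r j) r : Fin (m+1) → ℝ)) := by
  rw [measurable_pi_iff]
  intro i
  refine Fin.cases ?_ (fun i => ?_) i
  · simp only [Fin.cons_zero]; fun_prop
  · simp only [Fin.cons_succ]; fun_prop

/-- For independent `t_j ~ Gamma(n_j + 1, ρ_j)` (`j = 0,…,m`,
`n = m + ∑_j n_j`):
`P(t_0 ≤ ⋯ ≤ t_m) = (n!/∏_j n_j!) ∫_D ∏_j r_j^{n_j} dr_1⋯dr_m`, where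
`D = {r ∈ ℝ^m : r_j ≥ 0, ∑ r_j ≤ 1, and ρ_j r_{j−1} ≤ ρ_{j−1} r_j for j = 1,…,m}` with
`r_0 = 1 − ∑_{j≥1} r_j`. -/
theorem statement10 (m : ℕ) (nj : Fin (m + 1) → ℕ) (ρ : Fin (m + 1) → ℝ)
    (hρ : ∀ j, 0 < ρ j) :
    ((Measure.pi fun j => gammaMeasure ((nj j : ℝ) + 1) (ρ j))
        {t : Fin (m + 1) → ℝ | Monotone t}).toReal
      = (((m + ∑ j, nj j)! : ℝ) / ∏ j, ((nj j)! : ℝ)) *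
        ∫ r in {r : Fin m → ℝ | (∀ j, 0 ≤ r j) ∧ ∑ j, r j ≤ 1 ∧
            ∀ j : Fin m,
              ρ j.succ * (Fin.cons (1 - ∑ j', r j') r : Fin (m + 1) → ℝ) j.castSucc
                ≤ ρ j.castSucc * (Fin.cons (1 - ∑ j', r j') r : Fin (m + 1) → ℝ) j.succ},
          ∏ j : Fin (m + 1), ((Fin.cons (1 - ∑ j', r j') r : Fin (m + 1) → ℝ) j) ^ (nj j) := by
  set C : Set (Fin (m + 1) → ℝ) := {x | (∀ j, 0 ≤ x j) ∧
    ∀ j : Fin m, ρ j.succ * x j.castSucc ≤ ρ j.castSucc * x j.succ} with hC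
  have hCm : MeasurableSet C := by
    have hCe : C = (⋂ j, {x | 0 ≤ x j}) ∩
        ⋂ j : Fin m, {x | ρ j.succ * x j.castSucc ≤ ρ j.castSucc * x j.succ} := by
      ext x
      simp [hC]
    rw [hCe]
    refine (MeasurableSet.iInter fun j => ?_).inter (MeasurableSet.iInter fun j => ?_)
    · exact measurableSet_le (by fun_prop) (by fun_prop)
    · exact measurableSet_le (by fun_prop) (by fun_prop)
  set c : (Fin m → ℝ) → (Fin (m + 1) → ℝ) := fun r => Fin.cons (1 - ∑ j', r j') r with hc
  have hcm : Measurable c := aux_meas m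
  have hD : {r : Fin m → ℝ | (∀ j, 0 ≤ r j) ∧ ∑ j, r j ≤ 1 ∧
      ∀ j : Fin m, ρ j.succ * (Fin.cons (1 - ∑ j', r j') r : Fin (m + 1) → ℝ) j.castSucc
        ≤ ρ j.castSucc * (Fin.cons (1 - ∑ j', r j') r : Fin (m + 1) → ℝ) j.succ} = c ⁻¹' C := by
    ext r
    simp only [hC, hc, Set.mem_ofPred_eq, Set.mem_preimage]
    rw [Fin.forall_fin_succ (P := fun j => 0 ≤ (Fin.cons (1 - ∑ j', r j') r : Fin (m + 1) → ℝ) j)]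
    simp only [Fin.cons_zero, Fin.cons_succ, sub_nonneg]
    tauto
  rw [hD]
  have hDm : MeasurableSet (c ⁻¹' C) := hcm hCm
  have hMm : MeasurableSet {t : Fin (m + 1) → ℝ | Monotone t} := by
    apply IsClosed.measurableSet
    simp only [Fin.monotone_iff_le_succ, Set.ofPred_forall]
    exact isClosed_iInter fun j => isClosed_le (by fun_prop) (by fun_prop)
  have hpm : ∀ j, Measurable (gammaPDF ((nj j : ℝ) + 1) (ρ j)) := fun j =>
    (measurable_gammaPDFReal _ _).ennreal_ofReal
  have hK : 0 < ∏ j, ((nj j)! : ℝ) := Finset.prod_pos fun j _ => by positivity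
  -- the density in the rescaled coordinates
  set F : (Fin (m + 1) → ℝ) → ℝ≥0∞ := C.indicator
    (fun x => ENNReal.ofReal (∏ j, (x j ^ nj j * Real.exp (-x j) / ((nj j)! : ℝ)))) with hF
  have hFm : Measurable F := Measurable.indicator (by fun_prop) hCm
  have hprob : ∀ j, IsProbabilityMeasure
      (volume.withDensity (gammaPDF ((nj j : ℝ) + 1) (ρ j))) := fun j =>
    isProbabilityMeasure_gammaMeasure (by positivity) (hρ j)
  have h1 : (Measure.pi fun j => gammaMeasure ((nj j : ℝ) + 1) (ρ j))
      {t : Fin (m + 1) → ℝ | Monotone t} = ∫⁻ x, F x := by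
    have hGm : Measurable ({t : Fin (m + 1) → ℝ | Monotone t}.indicator
        (fun t => ∏ j, gammaPDF ((nj j : ℝ) + 1) (ρ j) (t j))) :=
      Measurable.indicator (by fun_prop) hMm
    unfold gammaMeasure
    rw [aux_pi _ _ hpm, withDensity_apply _ hMm, ← lintegral_indicator hMm,
      aux_diag _ ρ hρ _ hGm, ← lintegral_const_mul]
    · congr with x
      have hmono : Monotone (fun j => (ρ j)⁻¹ * x j) ↔
          ∀ j : Fin m, ρ j.succ * x j.castSucc ≤ ρ j.castSucc * x j.succ := by
        rw [Fin.monotone_iff_le_succ]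
        refine forall_congr' fun j => ?_
        have a := hρ j.succ
        have b := hρ j.castSucc
        rw [inv_mul_eq_div, inv_mul_eq_div, div_le_div_iff₀ b a, mul_comm (x j.castSucc),
          mul_comm (x j.succ)]
      have hprod : ENNReal.ofReal (∏ j, (ρ j)⁻¹) *
          ∏ j, gammaPDF ((nj j : ℝ) + 1) (ρ j) ((ρ j)⁻¹ * x j)
          = ∏ j, ENNReal.ofReal
            (if 0 ≤ x j then x j ^ nj j * Real.exp (-x j) / ((nj j)! : ℝ) else 0) := by
        rw [ENNReal.ofReal_prod_of_nonneg (fun j _ => (inv_pos.2 (hρ j)).le),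
          ← Finset.prod_mul_distrib]
        exact Finset.prod_congr rfl fun j _ => aux_pdf _ _ _ (hρ j)
      by_cases hpos : ∀ j, 0 ≤ x j
      · by_cases hmo : ∀ j : Fin m, ρ j.succ * x j.castSucc ≤ ρ j.castSucc * x j.succ
        · rw [hF, Set.indicator_of_mem (show x ∈ C from ⟨hpos, hmo⟩),
            Set.indicator_of_mem (by exact hmono.2 hmo), hprod, ENNReal.ofReal_prod_of_nonneg]
          · exact Finset.prod_congr rfl fun j _ => by rw [if_pos (hpos j)]
          · intro j _
            have := hpos j
            positivity
        · rw [hF, Set.indicator_of_notMem (show x ∉ C from fun h => hmo h.2),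
            Set.indicator_of_notMem (by exact fun h => hmo (hmono.1 h)), mul_zero]
      · rw [hF, Set.indicator_of_notMem (show x ∉ C from fun h => hpos h.1)]
        push Not at hpos
        obtain ⟨j, hj⟩ := hpos
        by_cases hmo : Monotone (fun j => (ρ j)⁻¹ * x j)
        · rw [Set.indicator_of_mem (by exact hmo), hprod]
          refine Finset.prod_eq_zero (Finset.mem_univ j) ?_
          rw [if_neg (not_le.2 hj), ENNReal.ofReal_zero]
        · rw [Set.indicator_of_notMem (by exact hmo), mul_zero]
    · exact hGm.comp (by fun_prop)
  have h2 : ∀ s : ℝ, 0 < s → ∀ r : Fin m → ℝ, ENNReal.ofReal (s ^ m) * F (s • c r)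
      = ENNReal.ofReal (s ^ (m + ∑ j, nj j) * Real.exp (-s)) *
        (c ⁻¹' C).indicator (fun r => ENNReal.ofReal ((∏ j, c r j ^ nj j) / ∏ j, ((nj j)! : ℝ))) r := by
    intro s hs r
    have hmem : s • c r ∈ C ↔ c r ∈ C := by
      simp only [hC, Set.mem_ofPred_eq, Pi.smul_apply, smul_eq_mul]
      refine and_congr (forall_congr' fun j => mul_nonneg_iff_of_pos_left hs)
        (forall_congr' fun j => ?_)
      rw [mul_left_comm, mul_left_comm _ s, mul_le_mul_iff_right₀ hs]
    by_cases h : c r ∈ C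
    · rw [hF, Set.indicator_of_mem (hmem.2 h), Set.indicator_of_mem (by exact h),
        ← ENNReal.ofReal_mul (by positivity), ← ENNReal.ofReal_mul (by positivity)]
      congr 1
      have hsum : ∑ j, c r j = 1 := by
        simp [hc, Fin.sum_univ_succ]
      simp only [Pi.smul_apply, smul_eq_mul]
      rw [Finset.prod_div_distrib, Finset.prod_mul_distrib, ← Real.exp_sum,
        Finset.sum_neg_distrib, ← Finset.mul_sum, hsum, mul_one, pow_add]
      simp_rw [mul_pow]
      rw [Finset.prod_mul_distrib, Finset.prod_pow_eq_pow_sum]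
      ring
    · rw [hF, Set.indicator_of_notMem (fun h' => h (hmem.1 h')), Set.indicator_of_notMem (by exact h),
        mul_zero, mul_zero]
  have hgm : Measurable (fun r => (∏ j, c r j ^ nj j) / ∏ j, ((nj j)! : ℝ)) := by
    fun_prop
  have h3 : ∫⁻ x, F x = ((m + ∑ j, nj j)! : ℝ≥0∞) *
      ∫⁻ r in c ⁻¹' C, ENNReal.ofReal ((∏ j, c r j ^ nj j) / ∏ j, ((nj j)! : ℝ)) := by
    rw [aux_polar m F hFm, ← aux_gamma, ← lintegral_mul_const]
    · refine setLIntegral_congr_fun measurableSet_Ioi fun s hs => ?_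
      rw [← lintegral_indicator hDm, ← lintegral_const_mul, ← lintegral_const_mul]
      · exact lintegral_congr fun r => h2 s hs r
      · exact Measurable.indicator hgm.ennreal_ofReal hDm
      · exact hFm.comp (hcm.const_smul s)
    · fun_prop
    · intro x j hj
      exact Set.indicator_of_notMem (fun h => absurd (h.1 j) (not_le.2 hj)) _
  have h4 : ∫ r in c ⁻¹' C, (∏ j, c r j ^ nj j) / ∏ j, ((nj j)! : ℝ)
      = (∫⁻ r in c ⁻¹' C, ENNReal.ofReal ((∏ j, c r j ^ nj j) / ∏ j, ((nj j)! : ℝ))).toReal := by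
    apply integral_eq_lintegral_of_nonneg_ae
    · filter_upwards [self_mem_ae_restrict hDm] with r hr
      exact div_nonneg (Finset.prod_nonneg fun j _ => pow_nonneg (hr.1 j) _) hK.le
    · exact hgm.aestronglyMeasurable
  rw [h1, h3, ENNReal.toReal_mul, ← h4, integral_div, ENNReal.toReal_natCast]
  simp only [hc]
  ring
end

section
/- Let m ≥ 0, let n_0, …, n_m be nonnegative integers, and let ρ_0, …, ρ_m > 0. Let t_0, …, t_m be independent random variables with t_j Gamma-distributed with shape n_j + 1 and rate ρ_j. Then P(t_0 ≤ t_1 ≤ ⋯ ≤ t_m) = ∫_0^∞ ∫_{(0,1)^m} ( ∏_{j=0}^{m} (ρ_j t_j)^{n_j + 1} e^{−ρ_j t_j} / n_j! ) · (1/t_0) du_1 ⋯ du_m dτ, where inside the integral t_m = τ and t_{j−1} = u_j · t_j for j = m, m−1, …, 1 (so t_j = τ · ∏_{l=j+1}^{m} u_l). -/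
open MeasureTheory ProbabilityTheory Finset Nat

lemma aux_vol0 : (volume : Measure (Fin 0 → ℝ)) Set.univ = 1 := by
  rw [volume_pi, Measure.pi_univ]
  simp

open scoped ENNReal in
lemma aux_lsnoc (n : ℕ) (g : (Fin (n + 1) → ℝ) → ℝ≥0∞) (hg : Measurable g) :
    ∫⁻ x, g x = ∫⁻ y : ℝ, ∫⁻ x' : Fin n → ℝ, g (Fin.snoc (α := fun _ => ℝ) x' y) := by
  have h := (volume_preserving_piFinSuccAbove (fun _ : Fin (n + 1) => ℝ) (Fin.last n)).symm
  rw [h.lintegral_map_equiv, Measure.volume_eq_prod, lintegral_prod]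
  · refine lintegral_congr fun y => lintegral_congr fun x' => ?_
    congr 1
    exact Fin.insertNth_last' y x'
  · exact (hg.comp (MeasurableEquiv.measurable _)).aemeasurable

lemma aux_snoc_meas (n : ℕ) :
    Measurable fun p : (Fin n → ℝ) × ℝ => (Fin.snoc (α := fun _ => ℝ) p.1 p.2 : Fin (n + 1) → ℝ) := by
  refine measurable_pi_iff.2 fun j => ?_
  refine Fin.lastCases ?_ (fun i => ?_) j
  · simpa using measurable_snd
  · simp only [Fin.snoc_castSucc]
    exact (measurable_pi_apply i).comp measurable_fst

open scoped ENNReal in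
lemma aux_lprod (n : ℕ) (F : Fin n → ℝ → ℝ≥0∞) (hF : ∀ j, Measurable (F j)) :
    ∫⁻ x : Fin n → ℝ, ∏ j, F j (x j) = ∏ j, ∫⁻ y, F j y := by
  induction n with
  | zero => simp [aux_vol0]
  | succ n ih =>
    rw [aux_lsnoc]
    · simp only [Fin.prod_univ_castSucc, Fin.snoc_castSucc, Fin.snoc_last]
      rw [← ih _ (fun j => hF _), ← lintegral_const_mul _ (hF _)]
      refine lintegral_congr fun y => ?_
      rw [lintegral_mul_const]
      exact Finset.measurable_prod _ fun j _ => (hF _).comp (measurable_pi_apply j)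
    · exact Finset.measurable_prod _ fun j _ => (hF _).comp (measurable_pi_apply j)

open scoped ENNReal in
lemma aux_pi_wd (n : ℕ) (F : Fin n → ℝ → ℝ≥0∞) (hF : ∀ j, Measurable (F j))
    [∀ j, SigmaFinite (volume.withDensity (F j))] :
    Measure.pi (fun j => volume.withDensity (F j))
      = (volume : Measure (Fin n → ℝ)).withDensity (fun x => ∏ j, F j (x j)) := by
  refine Measure.pi_eq fun s hs => ?_
  rw [withDensity_apply _ (MeasurableSet.univ_pi hs)]
  simp only [withDensity_apply _ (hs _)]
  rw [← lintegral_indicator (MeasurableSet.univ_pi hs)]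
  simp only [← lintegral_indicator (hs _)]
  rw [← aux_lprod _ _ (fun j => (hF j).indicator (hs j))]
  refine lintegral_congr fun x => ?_
  by_cases hx : x ∈ Set.univ.pi s
  · rw [Set.indicator_of_mem hx]
    refine Finset.prod_congr rfl fun j _ => ?_
    rw [Set.indicator_of_mem (hx j trivial)]
  · rw [Set.indicator_of_notMem hx]
    simp only [Set.mem_univ_pi, not_forall] at hx
    obtain ⟨j, hj⟩ := hx
    symm
    exact Finset.prod_eq_zero (Finset.mem_univ j) (Set.indicator_of_notMem hj _)

/-- the change of variables -/
noncomputable def auxT (m : ℕ) (τ : ℝ) (u : Fin m → ℝ) : Fin (m + 1) → ℝ := fun j =>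
  τ * ∏ l ∈ Finset.univ.filter (fun l : Fin m => (j : ℕ) ≤ (l : ℕ)), u l

lemma auxT_snoc (m : ℕ) (τ v : ℝ) (u : Fin m → ℝ) :
    auxT (m + 1) τ (Fin.snoc (α := fun _ => ℝ) u v)
      = Fin.snoc (α := fun _ => ℝ) (auxT m (τ * v) u) τ := by
  funext j
  refine Fin.lastCases ?_ (fun i => ?_) j
  · simp only [auxT, Fin.snoc_last, Finset.prod_filter, Fin.val_last]
    rw [Finset.prod_eq_one, mul_one]
    intro l _
    rw [if_neg (by have := l.isLt; omega)]
  · simp only [auxT, Fin.snoc_castSucc, Finset.prod_filter, Fin.prod_univ_castSucc, Fin.snoc_last,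
      Fin.val_castSucc, Fin.val_last]
    rw [if_pos (by have := i.isLt; omega)]
    ring

lemma auxT_meas (m : ℕ) : Measurable fun p : ℝ × (Fin m → ℝ) => auxT m p.1 p.2 := by
  refine measurable_pi_iff.2 fun j => ?_
  unfold auxT
  refine measurable_fst.mul (Finset.measurable_prod _ fun l _ => ?_)
  exact (measurable_pi_apply l).comp measurable_snd

lemma auxT_pos (m : ℕ) (τ : ℝ) (hτ : 0 < τ) (u : Fin m → ℝ) (hu : ∀ l, 0 < u l) (j) :
    0 < auxT m τ u j := by
  unfold auxT
  exact mul_pos hτ (Finset.prod_pos fun l _ => hu l)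

lemma auxT_last (m : ℕ) (τ : ℝ) (u : Fin m → ℝ) : auxT m τ u (Fin.last m) = τ := by
  simp only [auxT, Finset.prod_filter, Fin.val_last]
  rw [Finset.prod_eq_one, mul_one]
  intro l _
  rw [if_neg (by have := l.isLt; omega)]

open scoped ENNReal in
lemma aux_scale_s13 (y : ℝ) (hy : 0 < y) (G : ℝ → ℝ≥0∞) :
    ∫⁻ τ in Set.Ioo 0 y, G τ = ∫⁻ v in Set.Ioo (0 : ℝ) 1, ENNReal.ofReal y * G (y * v) := by
  have him : (fun v => y * v) '' Set.Ioo (0 : ℝ) 1 = Set.Ioo 0 y := by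
    rw [Set.image_mul_left_Ioo hy]; simp
  rw [← him, lintegral_image_eq_lintegral_abs_deriv_mul measurableSet_Ioo
    (f' := fun _ => y) (fun x _ => by simpa using ((hasDerivAt_id x).const_mul y).hasDerivWithinAt)
    (mul_right_injective₀ hy.ne').injOn]
  simp [abs_of_pos hy]

def auxS (m : ℕ) : Set (Fin (m + 1) → ℝ) := {x | Monotone x ∧ ∀ j, 0 < x j}

lemma auxMono_meas (m : ℕ) : MeasurableSet {x : Fin m → ℝ | Monotone x} := by
  have : {x : Fin m → ℝ | Monotone x} = ⋂ i, ⋂ j, ⋂ (_ : i ≤ j), {x | x i ≤ x j} := by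
    ext x; simp [Monotone]
  rw [this]
  refine MeasurableSet.iInter fun i => MeasurableSet.iInter fun j => MeasurableSet.iInter fun _ => ?_
  exact measurableSet_le (measurable_pi_apply i) (measurable_pi_apply j)

lemma auxS_meas (m : ℕ) : MeasurableSet (auxS m) := by
  refine (auxMono_meas _).inter ?_
  have : {x : Fin (m + 1) → ℝ | ∀ j, 0 < x j} = ⋂ j, {x | 0 < x j} := by ext x; simp
  change MeasurableSet {x : Fin (m + 1) → ℝ | ∀ j, 0 < x j}
  rw [this]
  exact MeasurableSet.iInter fun j => measurableSet_lt measurable_const (measurable_pi_apply j)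

lemma auxS_snoc (m : ℕ) (x : Fin (m + 1) → ℝ) (y : ℝ) :
    (Fin.snoc (α := fun _ => ℝ) x y : Fin (m + 2) → ℝ) ∈ auxS (m + 1)
      ↔ x ∈ auxS m ∧ x (Fin.last m) ≤ y := by
  constructor
  · rintro ⟨h1, h2⟩
    refine ⟨⟨fun i j hij => ?_, fun j => ?_⟩, ?_⟩
    · simpa using h1 (Fin.castSucc_le_castSucc_iff.2 hij)
    · simpa using h2 j.castSucc
    · simpa using h1 (Fin.le_last (Fin.last m).castSucc)
  · rintro ⟨⟨h1, h2⟩, h3⟩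
    refine ⟨fun i j => ?_, fun j => ?_⟩
    · refine Fin.lastCases ?_ (fun j => ?_) j
      · refine Fin.lastCases ?_ (fun i => ?_) i
        · intro _; exact le_rfl
        · intro _
          simpa using (h1 (Fin.le_last i)).trans h3
      · refine Fin.lastCases ?_ (fun i => ?_) i
        · intro h
          exact absurd h (not_le.2 (Fin.castSucc_lt_last j))
        · intro h
          simpa using h1 (Fin.castSucc_le_castSucc_iff.1 h)
    · refine Fin.lastCases ?_ (fun j => ?_) j
      · simpa using (h2 _).trans_le h3
      · simpa using h2 j

def auxC (m : ℕ) : Set (Fin m → ℝ) := Set.univ.pi fun _ : Fin m => Set.Ioo (0 : ℝ) 1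

lemma auxC_meas (m : ℕ) : MeasurableSet (auxC m) := MeasurableSet.univ_pi fun _ => measurableSet_Ioo

lemma auxC_snoc (m : ℕ) (x : Fin m → ℝ) (y : ℝ) :
    (Fin.snoc (α := fun _ => ℝ) x y : Fin (m + 1) → ℝ) ∈ auxC (m + 1)
      ↔ y ∈ Set.Ioo (0 : ℝ) 1 ∧ x ∈ auxC m := by
  simp only [auxC, Set.mem_univ_pi, Fin.forall_fin_succ', Fin.snoc_castSucc, Fin.snoc_last]
  exact and_comm

open scoped ENNReal in
lemma aux_cube (m : ℕ) (g : (Fin (m + 1) → ℝ) → ℝ≥0∞) (hg : Measurable g) :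
    ∫⁻ u in auxC (m + 1), g u = ∫⁻ v in Set.Ioo (0 : ℝ) 1, ∫⁻ u in auxC m,
      g (Fin.snoc (α := fun _ => ℝ) u v) := by
  rw [← lintegral_indicator (auxC_meas _), aux_lsnoc _ _ (hg.indicator (auxC_meas _)),
    ← lintegral_indicator measurableSet_Ioo]
  refine lintegral_congr fun y => ?_
  by_cases hy : y ∈ Set.Ioo (0 : ℝ) 1
  · rw [Set.indicator_of_mem hy, ← lintegral_indicator (auxC_meas _)]
    refine lintegral_congr fun x => ?_
    by_cases hx : x ∈ auxC m
    · rw [Set.indicator_of_mem hx, Set.indicator_of_mem ((auxC_snoc _ _ _).2 ⟨hy, hx⟩)]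
    · rw [Set.indicator_of_notMem hx,
        Set.indicator_of_notMem (fun h => hx ((auxC_snoc _ _ _).1 h).2)]
  · rw [Set.indicator_of_notMem hy]
    rw [lintegral_eq_zero_of_ae_eq_zero]
    refine Filter.Eventually.of_forall fun x => ?_
    exact Set.indicator_of_notMem (fun h => hy ((auxC_snoc _ _ _).1 h).1) _

open scoped ENNReal in
lemma aux_weight_meas (m : ℕ) (g : (Fin (m + 1) → ℝ) → ℝ≥0∞) (hg : Measurable g) :
    Measurable fun p : ℝ × (Fin m → ℝ) =>
      g (auxT m p.1 p.2) * ∏ j : Fin m, ENNReal.ofReal (auxT m p.1 p.2 j.succ) := by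
  refine (hg.comp (auxT_meas m)).mul (Finset.measurable_prod _ fun j _ => ?_)
  exact ENNReal.measurable_ofReal.comp ((measurable_pi_apply j.succ).comp (auxT_meas m))

open scoped ENNReal in
lemma aux_main (m : ℕ) (g : (Fin (m + 1) → ℝ) → ℝ≥0∞) (hg : Measurable g) :
    ∫⁻ x in auxS m, g x = ∫⁻ τ in Set.Ioi (0 : ℝ), ∫⁻ u in auxC m,
      g (auxT m τ u) * ∏ j : Fin m, ENNReal.ofReal (auxT m τ u j.succ) := by
  induction m with
  | zero =>
    have : Subsingleton (Fin (0 + 1)) := inferInstanceAs (Subsingleton (Fin 1))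
    have hC : auxC 0 = Set.univ := by ext x; simp [auxC]
    have hT : ∀ (τ : ℝ) u, auxT 0 τ u = fun _ => τ := by intro τ u; funext j; simp [auxT]
    have hS : auxS 0 = (MeasurableEquiv.funUnique (Fin 1) ℝ) ⁻¹' Set.Ioi 0 := by
      ext x
      simp only [auxS, Set.mem_ofPred_eq, Set.mem_preimage, Set.mem_Ioi]
      constructor
      · intro h; exact h.2 0
      · intro h
        refine ⟨Subsingleton.monotone _, fun j => ?_⟩
        rw [Subsingleton.elim j 0]; exact h
    rw [hC]
    simp only [hT, Finset.univ_eq_empty, Finset.prod_empty, mul_one, Measure.restrict_univ,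
      lintegral_const]
    simp only [aux_vol0, mul_one]
    rw [hS, ← (volume_preserving_funUnique (Fin 1) ℝ).setLIntegral_comp_preimage measurableSet_Ioi
      (f := fun τ => g fun _ => τ)]
    · refine lintegral_congr fun x => ?_
      congr 1
      funext j
      rw [Subsingleton.elim j 0]; rfl
    · exact hg.comp (measurable_pi_iff.2 fun _ => measurable_id)
  | succ m ih =>
    have key : ∀ y : ℝ, ∫⁻ x : Fin (m + 1) → ℝ,
        (auxS (m + 1)).indicator g (Fin.snoc (α := fun _ => ℝ) x y)
        = (Set.Ioi (0 : ℝ)).indicator (fun y => ∫⁻ u in auxC (m + 1),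
          g (auxT (m + 1) y u) * ∏ j : Fin (m + 1), ENNReal.ofReal (auxT (m + 1) y u j.succ)) y := by
      intro y
      have hA : MeasurableSet {x : Fin (m + 1) → ℝ | x (Fin.last m) ≤ y} :=
        measurableSet_le (measurable_pi_apply _) measurable_const
      have hgy : Measurable fun x : Fin (m + 1) → ℝ => g (Fin.snoc (α := fun _ => ℝ) x y) :=
        hg.comp ((aux_snoc_meas _).comp (measurable_id.prodMk measurable_const))
      have h1 : ∫⁻ x : Fin (m + 1) → ℝ,
          (auxS (m + 1)).indicator g (Fin.snoc (α := fun _ => ℝ) x y)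
          = ∫⁻ x in auxS m, ({x : Fin (m + 1) → ℝ | x (Fin.last m) ≤ y}).indicator
            (fun x => g (Fin.snoc (α := fun _ => ℝ) x y)) x := by
        rw [← lintegral_indicator (auxS_meas m)]
        refine lintegral_congr fun x => ?_
        classical
        simp only [Set.indicator_apply, auxS_snoc, Set.mem_ofPred_eq]
        by_cases h1 : x ∈ auxS m <;> by_cases h2 : x (Fin.last m) ≤ y <;> simp [h1, h2]
      rw [h1, ih _ (hgy.indicator hA)]
      have h2 : ∀ τ u, ({x : Fin (m + 1) → ℝ | x (Fin.last m) ≤ y}).indicator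
            (fun x => g (Fin.snoc (α := fun _ => ℝ) x y)) (auxT m τ u)
            * ∏ j : Fin m, ENNReal.ofReal (auxT m τ u j.succ)
          = (Set.Iic y).indicator (fun τ => g (Fin.snoc (α := fun _ => ℝ) (auxT m τ u) y)
            * ∏ j : Fin m, ENNReal.ofReal (auxT m τ u j.succ)) τ := by
        intro τ u
        classical
        simp only [Set.indicator_apply, Set.mem_ofPred_eq, auxT_last, Set.mem_Iic]
        split_ifs <;> simp
      simp only [h2]
      have h3 : ∀ τ, ∫⁻ u in auxC m,
          (Set.Iic y).indicator (fun τ => g (Fin.snoc (α := fun _ => ℝ) (auxT m τ u) y)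
            * ∏ j : Fin m, ENNReal.ofReal (auxT m τ u j.succ)) τ
          = (Set.Iic y).indicator (fun τ => ∫⁻ u in auxC m,
            g (Fin.snoc (α := fun _ => ℝ) (auxT m τ u) y)
            * ∏ j : Fin m, ENNReal.ofReal (auxT m τ u j.succ)) τ := by
        intro τ
        classical
        simp only [Set.indicator_apply]
        split_ifs <;> simp
      simp only [h3]
      rw [lintegral_indicator measurableSet_Iic, Measure.restrict_restrict measurableSet_Iic]
      have hI : Set.Iic y ∩ Set.Ioi 0 = Set.Ioc 0 y := by rw [Set.inter_comm]; rfl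
      rw [hI]
      by_cases hy : 0 < y
      · rw [Set.indicator_of_mem (Set.mem_Ioi.2 hy), ← restrict_Ioo_eq_restrict_Ioc,
          aux_scale_s13 y hy, aux_cube]
        · refine lintegral_congr fun v => ?_
          have hm := (aux_weight_meas m _ hgy).comp
            ((measurable_const (a := y * v)).prodMk (measurable_id (α := Fin m → ℝ)))
          refine (lintegral_const_mul _ hm).symm.trans (lintegral_congr fun u => ?_)
          simp only [auxT_snoc, Fin.prod_univ_castSucc, Fin.succ_last, Fin.snoc_last,
            Function.comp, id]
          have : ∀ j : Fin m, (Fin.snoc (α := fun _ => ℝ) (auxT m (y * v) u) y : Fin (m + 2) → ℝ)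
              j.castSucc.succ = auxT m (y * v) u j.succ := by
            intro j
            rw [Fin.succ_castSucc, Fin.snoc_castSucc]
          simp only [this]
          ring
        · exact (aux_weight_meas (m + 1) g hg).comp
            ((measurable_const (a := y)).prodMk measurable_id)
      · rw [Set.indicator_of_notMem (by simpa using hy), Set.Ioc_eq_empty hy]
        simp
    rw [← lintegral_indicator (auxS_meas _), aux_lsnoc _ _ (hg.indicator (auxS_meas _)),
      ← lintegral_indicator measurableSet_Ioi]
    exact lintegral_congr key

lemma aux_pdf_s13 (n : ℕ) (r t : ℝ) (hr : 0 < r) (ht : 0 < t) :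
    gammaPDF ((n : ℝ) + 1) r t
      = ENNReal.ofReal (r ^ (n + 1) * t ^ n * Real.exp (-(r * t)) / (n ! : ℝ)) := by
  rw [gammaPDF_of_nonneg ht.le, Real.Gamma_nat_eq_factorial, add_sub_cancel_right,
    Real.rpow_natCast, ← Nat.cast_succ, Real.rpow_natCast]
  congr 1
  simp only [Nat.succ_eq_add_one]
  ring

/-- For independent `t_j ~ Gamma(n_j + 1, ρ_j)` (`j = 0,…,m`):
`P(t_0 ≤ ⋯ ≤ t_m)
  = ∫_0^∞ ∫_{(0,1)^m} (∏_j (ρ_j t_j)^{n_j+1} e^{−ρ_j t_j}/n_j!) · (1/t_0) du dτ`,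
where inside the integral `t_m = τ` and `t_{j−1} = u_j t_j`, i.e.
`t_j = τ · ∏_{l=j+1}^m u_l` (the variable `u l` for `l : Fin m` stands for `u_{l+1}`). -/
theorem statement13 (m : ℕ) (nj : Fin (m + 1) → ℕ) (ρ : Fin (m + 1) → ℝ)
    (hρ : ∀ j, 0 < ρ j) :
    ((Measure.pi fun j => gammaMeasure ((nj j : ℝ) + 1) (ρ j))
        {t : Fin (m + 1) → ℝ | Monotone t}).toReal
      = ∫ τ in Set.Ioi (0 : ℝ),
          ∫ u in Set.univ.pi fun _ : Fin m => Set.Ioo (0 : ℝ) 1,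
            (let t : Fin (m + 1) → ℝ := fun j =>
              τ * ∏ l ∈ Finset.univ.filter (fun l : Fin m => (j : ℕ) ≤ (l : ℕ)), u l
            (∏ j : Fin (m + 1),
              (ρ j * t j) ^ (nj j + 1) * Real.exp (-(ρ j * t j)) / ((nj j)! : ℝ)) *
              (1 / t 0)) := by
  classical
  have hprob : ∀ j, IsProbabilityMeasure (gammaMeasure ((nj j : ℝ) + 1) (ρ j)) := fun j =>
    isProbabilityMeasure_gammaMeasure (by positivity) (hρ j)
  have hF : ∀ j, Measurable (gammaPDF ((nj j : ℝ) + 1) (ρ j)) := fun j =>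
    ENNReal.measurable_ofReal.comp (measurable_gammaPDFReal _ _)
  set μ := Measure.pi fun j => gammaMeasure ((nj j : ℝ) + 1) (ρ j) with hμ
  have hwd : μ = (volume : Measure (Fin (m + 1) → ℝ)).withDensity
      (fun x => ∏ j, gammaPDF ((nj j : ℝ) + 1) (ρ j) (x j)) := by
    have : ∀ j, SigmaFinite (volume.withDensity (gammaPDF ((nj j : ℝ) + 1) (ρ j))) := fun j => by
      have := hprob j
      unfold gammaMeasure at this
      infer_instance
    exact aux_pi_wd _ _ hF
  have hpos1 : ∀ j, ∀ᵐ x ∂(gammaMeasure ((nj j : ℝ) + 1) (ρ j)), 0 < x := by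
    intro j
    unfold gammaMeasure
    rw [ae_withDensity_iff (hF j)]
    have : ∀ᵐ x : ℝ, x ≠ 0 := by simp [ae_iff]
    filter_upwards [this] with x hx h
    by_contra h'
    exact h (gammaPDF_of_neg (lt_of_le_of_ne (not_lt.1 h') hx))
  have hpos : ∀ᵐ x ∂μ, ∀ j, 0 < x j := by
    rw [ae_all_iff]
    intro j
    exact Measure.tendsto_eval_ae_ae.eventually (hpos1 j)
  have hset : μ {t | Monotone t} = μ (auxS m) := by
    refine measure_congr ?_
    filter_upwards [hpos] with x hx
    exact propext ⟨fun h => ⟨h, hx⟩, fun h => h.1⟩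
  have hg : Measurable fun x : Fin (m + 1) → ℝ => ∏ j, gammaPDF ((nj j : ℝ) + 1) (ρ j) (x j) :=
    Finset.measurable_prod _ fun j _ => (hF j).comp (measurable_pi_apply j)
  have hfin : μ (auxS m) ≠ ⊤ := measure_ne_top _ _
  have hval : μ (auxS m) = ∫⁻ τ in Set.Ioi (0 : ℝ), ∫⁻ u in auxC m,
      (∏ j, gammaPDF ((nj j : ℝ) + 1) (ρ j) (auxT m τ u j)) *
        ∏ j : Fin m, ENNReal.ofReal (auxT m τ u j.succ) := by
    rw [hwd, withDensity_apply _ (auxS_meas m), aux_main m _ hg]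
  have hW := aux_weight_meas m _ hg
  rw [hset]
  rw [hval] at hfin ⊢
  have hm1 := hW.lintegral_prod_right' (ν := volume.restrict (auxC m))
  rw [← integral_toReal hm1.aemeasurable (ae_lt_top hm1 hfin)]
  refine setIntegral_congr_fun measurableSet_Ioi fun τ hτ => ?_
  have hm2 := hW.comp ((measurable_const (a := τ)).prodMk (measurable_id (α := Fin m → ℝ)))
  have hnt : ∀ u : Fin m → ℝ, (∏ j, gammaPDF ((nj j : ℝ) + 1) (ρ j) (auxT m τ u j))
      * ∏ j : Fin m, ENNReal.ofReal (auxT m τ u j.succ) < ⊤ := fun u =>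
    ENNReal.mul_lt_top (ENNReal.prod_lt_top fun _ _ => ENNReal.ofReal_lt_top)
      (ENNReal.prod_lt_top fun _ _ => ENNReal.ofReal_lt_top)
  change (∫⁻ u in auxC m, (∏ j, gammaPDF ((nj j : ℝ) + 1) (ρ j) (auxT m τ u j))
      * ∏ j : Fin m, ENNReal.ofReal (auxT m τ u j.succ)).toReal = ∫ u in auxC m,
      (∏ j : Fin (m + 1), (ρ j * auxT m τ u j) ^ (nj j + 1) *
        Real.exp (-(ρ j * auxT m τ u j)) / ((nj j)! : ℝ)) * (1 / auxT m τ u 0)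
  refine (integral_toReal hm2.aemeasurable (Filter.Eventually.of_forall hnt)).symm.trans ?_
  refine setIntegral_congr_fun (auxC_meas m) fun u hu => ?_
  have hT : ∀ j, 0 < auxT m τ u j := auxT_pos m τ hτ u fun l => (hu l trivial).1
  simp only [Function.comp, id]
  rw [ENNReal.toReal_mul, ENNReal.toReal_prod, ENNReal.toReal_prod]
  simp only [aux_pdf_s13 _ _ _ (hρ _) (hT _)]
  have e1 : ∀ j, (ENNReal.ofReal (ρ j ^ (nj j + 1) * auxT m τ u j ^ nj j *
      Real.exp (-(ρ j * auxT m τ u j)) / ((nj j)! : ℝ))).toReal =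
      ρ j ^ (nj j + 1) * auxT m τ u j ^ nj j *
      Real.exp (-(ρ j * auxT m τ u j)) / ((nj j)! : ℝ) := fun j => by
    refine ENNReal.toReal_ofReal ?_
    have := hρ j
    have := hT j
    positivity
  simp only [e1, ENNReal.toReal_ofReal (hT _).le]
  have e2 : ∀ j, (ρ j * auxT m τ u j) ^ (nj j + 1) *
        Real.exp (-(ρ j * auxT m τ u j)) / ((nj j)! : ℝ)
      = (ρ j ^ (nj j + 1) * auxT m τ u j ^ nj j *
      Real.exp (-(ρ j * auxT m τ u j)) / ((nj j)! : ℝ)) * auxT m τ u j := fun j => by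
    rw [mul_pow]; ring
  simp only [e2]
  rw [Finset.prod_mul_distrib, mul_assoc]
  congr 1
  rw [Fin.prod_univ_succ]
  have := (hT 0).ne'
  field_simp
end

section
/- Let V be a finite set with |V| = n+1, let F = (V_0, …, V_m) be an ordered partition of V into m+1 nonempty parts, and set k = n − m with k ≤ n−1 (so m ≥ 1). For λ in the open positive orthant of ℝ^V, define ρ_j(λ) = ∑_{i∈V_j} λ_i, define X_j(λ) = ∑_{i∈V_j} λ_i e_i ∈ ℝ^V, define p_F(λ) as the probability that t_0 ≤ ⋯ ≤ t_m for independent random variables t_j Gamma-distributed with shape |V_j| and rate ρ_j(λ), and define the k-form ψ̂_F by ψ̂_F(λ)(v_1, …, v_k) = (∏_{j=0}^{m} (|V_j|−1)!) · p_F(λ) · (∏_{j=0}^{m} ρ_j(λ)^{−|V_j|}) · det[X_0(λ), …, X_m(λ), v_1, …, v_k]. For 1 ≤ j ≤ m, let F_j be the flag obtained from F by replacing the consecutive parts V_{j−1} and V_j with their union V_{j−1} ∪ V_j, and let ψ̂_{F_j} be the corresponding (k+1)-form defined by the same formula. Then the map λ ↦ ψ̂_F(λ) is differentiable on the open positive orthant,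 and there exist signs ε_1, …, ε_m ∈ {−1, +1} such that for every λ in the open positive orthant and all vectors v_0, v_1, …, v_k ∈ ℝ^V: ∑_{l=0}^{k} (−1)^l (Dψ̂_F(λ)[v_l])(v_0, …, v_{l−1}, v_{l+1}, …, v_k) = ∑_{j=1}^{m} ε_j · ψ̂_{F_j}(λ)(v_0, …, v_k), where Dψ̂_F(λ)[v] denotes the Fréchet derivative of ψ̂_F at λ in the direction v. (The left-hand side is the exterior derivative dψ̂_F evaluated at (v_0, …, v_k).) -/
open MeasureTheory ProbabilityTheory Finset Nat

/-- The map `Fin (m+1) → Fin m` merging the two consecutive parts numbered `j` and `j+1`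
of an ordered partition with `m+1` parts (indices `≤ j` are kept, indices `> j` are
shifted down by one). -/
def mergeMap (m : ℕ) (j : Fin m) (i : Fin (m + 1)) : Fin m :=
  if h : (i : ℕ) ≤ (j : ℕ) then ⟨i, lt_of_le_of_lt h j.isLt⟩
  else ⟨(i : ℕ) - 1, by have hi := i.isLt; omega⟩

/-- The shadow (blow-up Whitney) form `ψ̂_F`, for a flag on `V` with `q` parts encoded by
`idx : V → Fin q`, evaluated at `λ = l` on the `k` vectors `v`:
`ψ̂_F(λ)(v) = (∏_j (|V_j|−1)!) · p_F(λ) · (∏_j ρ_j(λ)^{−|V_j|}) ·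
det[X_0(λ),…,X_{q−1}(λ),v_1,…,v_k]`, where
`ρ_j(λ) = ∑_{i∈V_j} λ_i`, `X_j(λ) = ∑_{i∈V_j} λ_i e_i`, `p_F(λ)` is the probability that
`t_0 ≤ ⋯ ≤ t_{q−1}` for independent `t_j ~ Gamma(|V_j|, ρ_j(λ))`, and the rows of the
determinant are ordered via the identification `e : Fin q ⊕ Fin k ≃ V`. -/
noncomputable def psiGen {V : Type*} [Fintype V] [DecidableEq V] (q k : ℕ)
    (idx : V → Fin q) (e : (Fin q ⊕ Fin k) ≃ V) (l : V → ℝ) (v : Fin k → V → ℝ) : ℝ :=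
  (∏ j : Fin q, (((Finset.univ.filter (fun i => idx i = j)).card - 1)! : ℝ)) *
  ((Measure.pi fun j : Fin q =>
      gammaMeasure ((Finset.univ.filter (fun i => idx i = j)).card : ℝ)
        (∑ i ∈ Finset.univ.filter (fun i => idx i = j), l i))
    {t : Fin q → ℝ | Monotone t}).toReal *
  (∏ j : Fin q, (∑ i ∈ Finset.univ.filter (fun i => idx i = j), l i) ^
      (Finset.univ.filter (fun i => idx i = j)).card)⁻¹ *
  Matrix.det (Matrix.of fun (r c : Fin q ⊕ Fin k) =>
    Sum.elim (fun j (i : V) => if idx i = j then l i else 0) v c (e r))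


/-- One-dimensional kernel `x ^ n * exp (-r x)` on the half-line. -/
noncomputable def kerW (n : ℕ) (r x : ℝ) : ℝ := if 0 ≤ x then x ^ n * Real.exp (-(r * x)) else 0

/-- The cone integral. -/
noncomputable def coneG {q : ℕ} (n : Fin q → ℕ) (ρ : Fin q → ℝ) : ℝ :=
  ∫ t in {t : Fin q → ℝ | Monotone t}, ∏ j, kerW (n j) (ρ j) (t j)

lemma kerW_nonneg (n : ℕ) (r x : ℝ) : 0 ≤ kerW n r x := by
  unfold kerW; split_ifs <;> positivity

lemma kerW_measurable (n : ℕ) (r : ℝ) : Measurable (kerW n r) := by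
  unfold kerW
  exact Measurable.ite measurableSet_Ici (by fun_prop) measurable_const

lemma kerW_integrable (n : ℕ) {r : ℝ} (hr : 0 < r) : Integrable (kerW n r) := by
  have h := integrableOn_rpow_mul_exp_neg_mul_rpow (p := 1) (s := n) (b := r)
    (by have : (0:ℝ) ≤ n := by positivity
        linarith) one_pos hr
  have h2 : IntegrableOn (fun x : ℝ => x ^ n * Real.exp (-(r * x))) (Set.Ici 0) := by
    rw [integrableOn_Ici_iff_integrableOn_Ioi]
    refine h.congr_fun (fun x hx => ?_) measurableSet_Ioi
    simp
  have h3 : kerW n r = (Set.Ici 0).indicator (fun x : ℝ => x ^ n * Real.exp (-(r * x))) := by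
    ext x; simp [kerW, Set.indicator]
  rw [h3]
  exact h2.integrable_indicator measurableSet_Ici

lemma kerW_anti (n : ℕ) {r s : ℝ} (h : r ≤ s) (x : ℝ) : kerW n s x ≤ kerW n r x := by
  unfold kerW
  split_ifs with hx
  · gcongr
  · exact le_rfl

lemma kerW_hasDerivAt (n : ℕ) (r x : ℝ) :
    HasDerivAt (fun r => kerW n r x) (-kerW (n + 1) r x) r := by
  unfold kerW
  split_ifs with hx
  · have h1 : HasDerivAt (fun r : ℝ => -(r * x)) (-(1 * x)) r := ((hasDerivAt_id r).mul_const x).neg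
    refine ((h1.exp).const_mul (x ^ n)).congr_deriv ?_
    ring
  · simpa using hasDerivAt_const r (0:ℝ)

lemma prodW_integrable {q : ℕ} (n : Fin q → ℕ) {ρ : Fin q → ℝ} (hρ : ∀ j, 0 < ρ j) :
    Integrable (fun t : Fin q → ℝ => ∏ j, kerW (n j) (ρ j) (t j)) :=
  Integrable.fintype_prod (f := fun j x => kerW (n j) (ρ j) x) (fun j => kerW_integrable _ (hρ j))

lemma prodW_measurable {q : ℕ} (n : Fin q → ℕ) (ρ : Fin q → ℝ) :
    Measurable (fun t : Fin q → ℝ => ∏ j, kerW (n j) (ρ j) (t j)) := by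
  refine Finset.measurable_fun_prod _ (fun j _ => ?_)
  exact (kerW_measurable _ _).comp (measurable_pi_apply j)

lemma measurableSet_mono (q : ℕ) : MeasurableSet {t : Fin q → ℝ | Monotone t} :=
  isClosed_monotone.measurableSet

/-- raise the `j`-th exponent by one -/
def bump {q : ℕ} (n : Fin q → ℕ) (j : Fin q) : Fin q → ℕ := Function.update n j (n j + 1)

lemma prodW_bump {q : ℕ} (n : Fin q → ℕ) (ρ t : Fin q → ℝ) (j : Fin q) :
    ∏ i, kerW (bump n j i) (ρ i) (t i) =
      (∏ i ∈ Finset.univ.erase j, kerW (n i) (ρ i) (t i)) * kerW (n j + 1) (ρ j) (t j) := by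
  rw [← Finset.prod_erase_mul _ _ (Finset.mem_univ j)]
  congr 1
  · refine Finset.prod_congr rfl (fun i hi => ?_)
    rw [bump, Function.update_of_ne (Finset.ne_of_mem_erase hi)]
  · simp [bump]

lemma prodW_hasFDerivAt {q : ℕ} (n : Fin q → ℕ) (ρ t : Fin q → ℝ) :
    HasFDerivAt (fun ρ : Fin q → ℝ => ∏ j, kerW (n j) (ρ j) (t j))
      (∑ j, (-∏ i, kerW (bump n j i) (ρ i) (t i)) • 
        (ContinuousLinearMap.proj j : (Fin q → ℝ) →L[ℝ] ℝ)) ρ := by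
  have h := HasFDerivAt.finsetProd (u := Finset.univ) (x := ρ)
    (g := fun j (ρ : Fin q → ℝ) => kerW (n j) (ρ j) (t j))
    (g' := fun j => (-kerW (n j + 1) (ρ j) (t j)) •
      (ContinuousLinearMap.proj j : (Fin q → ℝ) →L[ℝ] ℝ))
    (fun j _ => by
      have := (kerW_hasDerivAt (n j) (ρ j) (t j)).comp_hasFDerivAt ρ
        (ContinuousLinearMap.proj j : (Fin q → ℝ) →L[ℝ] ℝ).hasFDerivAt
      exact this)
  refine h.congr_fderiv ?_
  refine Finset.sum_congr rfl (fun j _ => ?_)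
  rw [prodW_bump, smul_smul]
  congr 1
  ring

lemma coneG_hasFDerivAt {q : ℕ} (n : Fin q → ℕ) {ρ : Fin q → ℝ} (hρ : ∀ j, 0 < ρ j) :
    HasFDerivAt (coneG n) (∑ j, (-coneG (bump n j) ρ) •
        (ContinuousLinearMap.proj j : (Fin q → ℝ) →L[ℝ] ℝ)) ρ := by
  have key := hasFDerivAt_integral_of_dominated_of_fderiv_le (𝕜 := ℝ)
    (μ := volume.restrict {t : Fin q → ℝ | Monotone t})
    (F := fun (ρ t : Fin q → ℝ) => ∏ j, kerW (n j) (ρ j) (t j))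
    (F' := fun (ρ t : Fin q → ℝ) => ∑ j, (-∏ i, kerW (bump n j i) (ρ i) (t i)) • 
        (ContinuousLinearMap.proj j : (Fin q → ℝ) →L[ℝ] ℝ))
    (x₀ := ρ) (s := Set.pi Set.univ (fun j => Set.Ioi (ρ j / 2)))
    (bound := fun t => ∑ j, ∏ i, kerW (bump n j i) (ρ i / 2) (t i))
    (set_pi_mem_nhds Set.finite_univ (fun j _ => Ioi_mem_nhds (by linarith [hρ j])))
    (Filter.Eventually.of_forall (fun x => (prodW_measurable n x).aestronglyMeasurable))
    (prodW_integrable n hρ).restrict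
    (by
      refine Measurable.aestronglyMeasurable ?_
      refine Finset.measurable_fun_sum _ (fun j _ => ?_)
      exact ((prodW_measurable (bump n j) ρ).neg).smul_const _)
    (by
      refine Filter.Eventually.of_forall (fun t x hx => ?_)
      refine (norm_sum_le _ _).trans (Finset.sum_le_sum (fun j _ => ?_))
      rw [norm_smul, norm_neg, Real.norm_of_nonneg (Finset.prod_nonneg fun _ _ => kerW_nonneg _ _ _)]
      have h1 : ‖(ContinuousLinearMap.proj j : (Fin q → ℝ) →L[ℝ] ℝ)‖ ≤ 1 := by
        refine ContinuousLinearMap.opNorm_le_bound _ zero_le_one (fun y => ?_)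
        simpa using norm_le_pi_norm y j
      have h2 : ∏ i, kerW (bump n j i) (x i) (t i) ≤ ∏ i, kerW (bump n j i) (ρ i / 2) (t i) :=
        Finset.prod_le_prod (fun _ _ => kerW_nonneg _ _ _)
          (fun i _ => kerW_anti _ (le_of_lt (hx i (Set.mem_univ i))) _)
      calc _ ≤ (∏ i, kerW (bump n j i) (x i) (t i)) * 1 := by
            gcongr
            exact Finset.prod_nonneg fun _ _ => kerW_nonneg _ _ _
        _ ≤ _ := by simpa using h2)
    (by
      refine integrable_finsetSum _ (fun j _ => ?_)
      exact (prodW_integrable _ (fun i => by linarith [hρ i])).restrict)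
    (Filter.Eventually.of_forall (fun t x _ => prodW_hasFDerivAt n x t))
  refine key.congr_fderiv ?_
  unfold coneG
  rw [integral_finsetSum]
  · refine Finset.sum_congr rfl (fun j _ => ?_)
    rw [integral_smul_const, integral_neg]
  · intro j _
    exact ((prodW_integrable (bump n j) hρ).restrict.neg).smul_const _

lemma integrable_prod_vol {q : ℕ} {g : Fin q → ℝ → ℝ} (hg : ∀ j, Integrable (g j)) :
    Integrable (fun t : Fin q → ℝ => ∏ j, g j (t j)) :=
  Integrable.fintype_prod (f := g) hg

lemma pi_withDensity_aux {q : ℕ} (g : Fin q → ℝ → ℝ) (hg : ∀ j, Integrable (g j))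
    (hg0 : ∀ j x, 0 ≤ g j x)
    [∀ j, SigmaFinite ((volume : Measure ℝ).withDensity (fun x => ENNReal.ofReal (g j x)))] :
    Measure.pi (fun j => (volume : Measure ℝ).withDensity (fun x => ENNReal.ofReal (g j x))) =
      (volume : Measure (Fin q → ℝ)).withDensity
        (fun t => ENNReal.ofReal (∏ j, g j (t j))) := by
  refine Measure.pi_eq (fun s hs => ?_)
  rw [withDensity_apply _ (MeasurableSet.univ_pi hs),
    ← lintegral_indicator (MeasurableSet.univ_pi hs)]
  have h1 : (Set.univ.pi s).indicator (fun t : Fin q → ℝ => ENNReal.ofReal (∏ j, g j (t j))) =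
      fun t => ENNReal.ofReal (∏ j, (s j).indicator (g j) (t j)) := by
    ext t
    by_cases h : t ∈ Set.univ.pi s
    · rw [Set.indicator_of_mem h]
      congr 1
      refine Finset.prod_congr rfl (fun j _ => ?_)
      rw [Set.indicator_of_mem (h j (Set.mem_univ j))]
    · rw [Set.indicator_of_notMem h]
      simp only [Set.mem_pi, Set.mem_univ, true_imp_iff, not_forall] at h
      obtain ⟨j, hj⟩ := h
      rw [Finset.prod_eq_zero (Finset.mem_univ j)]
      · simp
      · rw [Set.indicator_of_notMem hj]
  have hi : ∀ j, Integrable ((s j).indicator (g j)) := fun j => (hg j).indicator (hs j)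
  have hi0 : ∀ j x, 0 ≤ (s j).indicator (g j) x :=
    fun j x => Set.indicator_nonneg (fun y _ => hg0 j y) x
  rw [h1, ← ofReal_integral_eq_lintegral_ofReal
    (integrable_prod_vol (g := fun j x => (s j).indicator (g j) x) hi)
    (Filter.Eventually.of_forall fun t => Finset.prod_nonneg fun j _ => hi0 j _),
    integral_fintype_prod_volume_eq_prod (f := fun j x => (s j).indicator (g j) x),
    ENNReal.ofReal_prod_of_nonneg (fun j _ => integral_nonneg (hi0 j))]
  refine Finset.prod_congr rfl (fun j _ => ?_)
  rw [ofReal_integral_eq_lintegral_ofReal (hi j) (Filter.Eventually.of_forall (hi0 j)),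
    withDensity_apply _ (hs j), ← lintegral_indicator (hs j)]
  congr 1
  ext x
  by_cases h : x ∈ s j <;> simp [h]

lemma gammaPDFReal_eq_kerW {N : ℕ} (hN : 1 ≤ N) {r : ℝ} (x : ℝ) :
    gammaPDFReal (N : ℝ) r x = (r ^ N / ((N - 1)! : ℝ)) * kerW (N - 1) r x := by
  obtain ⟨n, rfl⟩ : ∃ n, N = n + 1 := ⟨N - 1, by omega⟩
  unfold gammaPDFReal kerW
  split_ifs with hx
  · rw [Real.rpow_natCast]
    push_cast
    rw [Real.Gamma_nat_eq_factorial, add_sub_cancel_right, Real.rpow_natCast]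
    ring_nf
  · simp

lemma prob_eq {q : ℕ} (N : Fin q → ℕ) (hN : ∀ j, 1 ≤ N j) (ρ : Fin q → ℝ) (hρ : ∀ j, 0 < ρ j) :
    (∏ j : Fin q, ((N j - 1)! : ℝ)) *
      ((Measure.pi fun j : Fin q => gammaMeasure (N j : ℝ) (ρ j))
        {t : Fin q → ℝ | Monotone t}).toReal *
      (∏ j : Fin q, ρ j ^ N j)⁻¹ = coneG (fun j => N j - 1) ρ := by
  have hp : ∀ j, 0 < ((N j : ℕ) : ℝ) := fun j => by exact_mod_cast hN j
  have hprob : ∀ j, IsProbabilityMeasure ((volume : Measure ℝ).withDensity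
      (fun x => ENNReal.ofReal (gammaPDFReal (N j : ℝ) (ρ j) x))) :=
    fun j => isProbabilityMeasure_gammaMeasure (hp j) (hρ j)
  have h0 : ∀ j x, 0 ≤ gammaPDFReal (N j : ℝ) (ρ j) x :=
    fun j x => gammaPDFReal_nonneg (hp j) (hρ j) x
  have hIntg : ∀ j, Integrable (gammaPDFReal (N j : ℝ) (ρ j)) := fun j => by
    rw [show gammaPDFReal (N j : ℝ) (ρ j) = _ from funext (gammaPDFReal_eq_kerW (hN j))]
    exact (kerW_integrable _ (hρ j)).const_mul _
  have e1 := pi_withDensity_aux (fun j => gammaPDFReal (N j : ℝ) (ρ j)) hIntg h0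
  have e2 : (Measure.pi fun j : Fin q => gammaMeasure (N j : ℝ) (ρ j)) =
    (volume : Measure (Fin q → ℝ)).withDensity
        (fun t => ENNReal.ofReal (∏ j, gammaPDFReal (N j : ℝ) (ρ j) (t j))) := e1
  rw [e2, withDensity_apply _ (measurableSet_mono q), ← integral_eq_lintegral_of_nonneg_ae
    (Filter.Eventually.of_forall fun t => Finset.prod_nonneg fun j _ => h0 j _)
    (integrable_prod_vol (g := fun j x => gammaPDFReal (N j : ℝ) (ρ j) x)
      hIntg).aestronglyMeasurable.restrict]
  have e3 : ∀ t : Fin q → ℝ, ∏ j, gammaPDFReal (N j : ℝ) (ρ j) (t j) =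
      (∏ j, (ρ j ^ N j / ((N j - 1)! : ℝ))) * ∏ j, kerW (N j - 1) (ρ j) (t j) := fun t => by
    rw [← Finset.prod_mul_distrib]
    exact Finset.prod_congr rfl fun j _ => gammaPDFReal_eq_kerW (hN j) _
  simp_rw [e3]
  rw [integral_const_mul, Finset.prod_div_distrib]
  have n1 : (∏ j : Fin q, ((N j - 1)! : ℝ)) ≠ 0 := Finset.prod_ne_zero_iff.2 fun j _ => by positivity
  have n2 : (∏ j : Fin q, ρ j ^ N j) ≠ 0 :=
    Finset.prod_ne_zero_iff.2 fun j _ => (pow_pos (hρ j) _).ne'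
  unfold coneG
  field_simp

lemma mono_insertNth_iff {m : ℕ} (j : Fin (m + 1)) (x : ℝ) (t : Fin m → ℝ) :
    Monotone (j.insertNth x t : Fin (m + 1) → ℝ) ↔ Monotone t ∧
      (∀ i : Fin m, i.castSucc < j → t i ≤ x) ∧ (∀ i : Fin m, j ≤ i.castSucc → x ≤ t i) := by
  constructor
  · intro h
    refine ⟨fun a b hab => ?_, fun i hi => ?_, fun i hi => ?_⟩
    · have := h (a := j.succAbove a) (b := j.succAbove b) ((Fin.strictMono_succAbove j).monotone hab)
      simpa using this
    · have := h (a := j.succAbove i) (b := j)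
        (by rw [Fin.succAbove_of_castSucc_lt _ _ hi]; exact hi.le)
      simpa using this
    · have := h (a := j) (b := j.succAbove i)
        (by rw [Fin.succAbove_of_le_castSucc _ _ hi]; exact hi.trans (Fin.castSucc_lt_succ).le)
      simpa using this
  · rintro ⟨h1, h2, h3⟩ a b hab
    induction a using Fin.succAboveCases j with
    | x => 
      induction b using Fin.succAboveCases j with
      | x => exact le_rfl
      | p b =>
        simp only [Fin.insertNth_apply_same, Fin.insertNth_apply_succAbove]
        refine h3 b ?_
        by_contra hlt
        rw [not_le] at hlt
        rw [Fin.succAbove_of_castSucc_lt _ _ hlt] at hab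
        exact absurd hab (not_le.2 hlt)
    | p a =>
      induction b using Fin.succAboveCases j with
      | x =>
        simp only [Fin.insertNth_apply_same, Fin.insertNth_apply_succAbove]
        refine h2 a ?_
        by_contra hlt
        rw [not_lt] at hlt
        rw [Fin.succAbove_of_le_castSucc _ _ hlt] at hab
        exact absurd (hlt.trans_lt Fin.castSucc_lt_succ) (not_lt.2 hab)
      | p b =>
        simp only [Fin.insertNth_apply_succAbove]
        exact h1 ((Fin.strictMono_succAbove j).le_iff_le.1 hab)

/-- derivative of `kerW (n+1) r` on the positive half-line -/
noncomputable def kerD (n : ℕ) (r x : ℝ) : ℝ := (n + 1) * kerW n r x - r * kerW (n + 1) r x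

lemma kerD_integrable (n : ℕ) {r : ℝ} (hr : 0 < r) : Integrable (kerD n r) :=
  ((kerW_integrable n hr).const_mul _).sub ((kerW_integrable (n + 1) hr).const_mul _)

lemma kerD_of_neg (n : ℕ) (r : ℝ) {x : ℝ} (hx : x < 0) : kerD n r x = 0 := by
  simp [kerD, kerW, not_le.2 hx]

lemma pow_exp_hasDerivAt (n : ℕ) (r x : ℝ) :
    HasDerivAt (fun x : ℝ => x ^ (n + 1) * Real.exp (-(r * x)))
      ((n + 1) * (x ^ n * Real.exp (-(r * x))) - r * (x ^ (n + 1) * Real.exp (-(r * x)))) x := by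
  have h1 : HasDerivAt (fun x : ℝ => -(r * x)) (-(r * 1)) x := ((hasDerivAt_id x).const_mul r).neg
  refine ((hasDerivAt_pow (n + 1) x).mul h1.exp).congr_deriv ?_
  push_cast
  ring

lemma kerD_of_nonneg (n : ℕ) (r : ℝ) {x : ℝ} (hx : 0 ≤ x) : kerD n r x =
    (n + 1) * (x ^ n * Real.exp (-(r * x))) - r * (x ^ (n + 1) * Real.exp (-(r * x))) := by
  simp [kerD, kerW, hx]

lemma kerW_of_nonneg (n : ℕ) (r : ℝ) {x : ℝ} (hx : 0 ≤ x) :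
    kerW n r x = x ^ n * Real.exp (-(r * x)) := by
  simp [kerW, hx]

lemma integral_kerD_Icc (n : ℕ) (r : ℝ) {a b : ℝ} (ha : 0 ≤ a) (hab : a ≤ b) :
    ∫ x in Set.Icc a b, kerD n r x = kerW (n + 1) r b - kerW (n + 1) r a := by
  rw [setIntegral_congr_fun measurableSet_Icc
    (g := fun x => (n + 1) * (x ^ n * Real.exp (-(r * x))) - r * (x ^ (n + 1) * Real.exp (-(r * x))))
    (fun x hx => kerD_of_nonneg n r (ha.trans hx.1)), integral_Icc_eq_integral_Ioc,
    ← intervalIntegral.integral_of_le hab,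
    intervalIntegral.integral_eq_sub_of_hasDerivAt (fun x _ => pow_exp_hasDerivAt n r x),
    kerW_of_nonneg _ _ ha, kerW_of_nonneg _ _ (ha.trans hab)]
  exact Continuous.intervalIntegrable (by fun_prop) _ _

lemma integral_kerD_Ici (n : ℕ) {r : ℝ} (hr : 0 < r) {a : ℝ} (ha : 0 ≤ a) :
    ∫ x in Set.Ici a, kerD n r x = 0 - kerW (n + 1) r a := by
  have hIntg : IntegrableOn (kerD n r) (Set.Ici a) := (kerD_integrable n hr).integrableOn
  have hc : ∀ x ∈ Set.Ici a, kerD n r x =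
    (n + 1) * (x ^ n * Real.exp (-(r * x))) - r * (x ^ (n + 1) * Real.exp (-(r * x))) :=
    fun x hx => kerD_of_nonneg n r (ha.trans hx)
  rw [setIntegral_congr_fun measurableSet_Ici hc, integral_Ici_eq_integral_Ioi]
  have hIntg2 := (hIntg.congr_fun hc measurableSet_Ici).mono_set Set.Ioi_subset_Ici_self
  rw [integral_Ioi_of_hasDerivAt_of_tendsto' (fun x _ => pow_exp_hasDerivAt n r x) hIntg2 (m := 0),
    kerW_of_nonneg _ _ ha]
  have := tendsto_rpow_mul_exp_neg_mul_atTop_nhds_zero ((n + 1 : ℕ) : ℝ) r hr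
  simpa only [Real.rpow_natCast, neg_mul] using this

/-- Fibre integral over the inserted coordinate. -/
lemma inner_integral {m : ℕ} (j : Fin (m + 1)) (n : ℕ) {r : ℝ} (hr : 0 < r) (t : Fin m → ℝ)
    (ht : Monotone t) (ht0 : ∀ i, 0 ≤ t i) :
    ∫ x, {x : ℝ | Monotone (j.insertNth x t : Fin (m + 1) → ℝ)}.indicator (kerD n r) x =
      (if h : (j : ℕ) < m then kerW (n + 1) r (t ⟨j, h⟩) else 0) -
      (if h : 0 < (j : ℕ) then kerW (n + 1) r (t ⟨j - 1, by omega⟩) else 0) := by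
  obtain ⟨a, ha0, haK, ha⟩ : ∃ a : ℝ, 0 ≤ a ∧
      (if h : 0 < (j : ℕ) then kerW (n + 1) r (t ⟨j - 1, by omega⟩) else 0) = kerW (n + 1) r a ∧
      (∀ x, 0 ≤ x → ((∀ i : Fin m, i.castSucc < j → t i ≤ x) ↔ a ≤ x)) ∧
      (∀ h : (j : ℕ) < m, a ≤ t ⟨j, h⟩) := by
    by_cases h : 0 < (j : ℕ)
    · refine ⟨t ⟨j - 1, by omega⟩, ht0 _, by simp [h], fun x hx => ⟨fun H => H _ ?_, fun H i hi => ?_⟩,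
        fun h => ht ?_⟩
      · rw [Fin.lt_def]
        change (j : ℕ) - 1 < (j : ℕ)
        omega
      · refine (ht ?_).trans H
        rw [Fin.lt_def] at hi; rw [Fin.le_def]; simp at hi ⊢; omega
      · rw [Fin.le_def]; simp
    · refine ⟨0, le_rfl, by simp [h, kerW], fun x hx => ⟨fun _ => hx, fun _ i hi => ?_⟩,
        fun h => ht0 _⟩
      rw [Fin.lt_def] at hi; omega
  obtain ⟨ha, hab⟩ := ha
  rw [haK]
  have hset : ∀ S : Set ℝ, MeasurableSet S → (∀ x, 0 ≤ x →
      (Monotone (j.insertNth x t : Fin (m + 1) → ℝ) ↔ x ∈ S)) → S ⊆ Set.Ici 0 →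
      ∫ x, {x : ℝ | Monotone (j.insertNth x t : Fin (m + 1) → ℝ)}.indicator (kerD n r) x =
      ∫ x in S, kerD n r x := by
    intro S hS h1 h2
    rw [← integral_indicator hS]
    congr 1
    ext x
    by_cases hx : 0 ≤ x
    · by_cases hxS : x ∈ S
      · rw [Set.indicator_of_mem hxS, Set.indicator_of_mem]
        exact (h1 x hx).2 hxS
      · rw [Set.indicator_of_notMem hxS, Set.indicator_of_notMem]
        exact fun h => hxS ((h1 x hx).1 h)
    · rw [Set.indicator_of_notMem (fun h => hx (h2 h))]
      simp [Set.indicator, kerD_of_neg n r (not_le.1 hx)]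
  by_cases h : (j : ℕ) < m
  · rw [dif_pos h, hset (Set.Icc a (t ⟨j, h⟩)) measurableSet_Icc, integral_kerD_Icc n r ha0 (hab h)]
    · intro x hx
      rw [mono_insertNth_iff, ha x hx, Set.mem_Icc]
      refine ⟨fun H => ⟨H.2.1, H.2.2 _ ?_⟩, fun H => ⟨ht, H.1, fun i hi => H.2.trans (ht ?_)⟩⟩
      · rw [Fin.le_def]; simp
      · rw [Fin.le_def] at hi ⊢; simpa using hi
    · exact fun x hx => ha0.trans hx.1
  · rw [dif_neg h, hset (Set.Ici a) measurableSet_Ici, integral_kerD_Ici n hr ha0]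
    · intro x hx
      rw [mono_insertNth_iff, ha x hx, Set.mem_Ici]
      refine ⟨fun H => H.2.1, fun H => ⟨ht, H, fun i hi => ?_⟩⟩
      rw [Fin.le_def] at hi; simp at hi; omega
    · exact fun x hx => ha0.trans hx

/-- merged exponents: delete part `j`, and add it to part `p` -/
def mrgN {m : ℕ} (n : Fin (m + 1) → ℕ) (j : Fin (m + 1)) (p : Fin m) : Fin m → ℕ :=
  fun i => n (j.succAbove i) + if i = p then n j + 1 else 0

/-- merged rates -/
noncomputable def mrgR {m : ℕ} (ρ : Fin (m + 1) → ℝ) (j : Fin (m + 1)) (p : Fin m) : Fin m → ℝ :=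
  fun i => ρ (j.succAbove i) + if i = p then ρ j else 0

lemma kerW_mul (a b : ℕ) (r s x : ℝ) : kerW a r x * kerW b s x = kerW (a + b) (r + s) x := by
  unfold kerW
  split_ifs
  · rw [pow_add, show -((r + s) * x) = -(r * x) + -(s * x) by ring, Real.exp_add]; ring
  · simp

lemma prod_mrg {m : ℕ} (n : Fin (m + 1) → ℕ) (ρ : Fin (m + 1) → ℝ) (j : Fin (m + 1)) (p : Fin m)
    (t : Fin m → ℝ) :
    (∏ i, kerW (n (j.succAbove i)) (ρ (j.succAbove i)) (t i)) * kerW (n j + 1) (ρ j) (t p) =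
      ∏ i, kerW (mrgN n j p i) (mrgR ρ j p i) (t i) := by
  rw [← Finset.prod_erase_mul _ _ (Finset.mem_univ p), mul_assoc, kerW_mul,
    ← Finset.prod_erase_mul Finset.univ (fun i => kerW (mrgN n j p i) _ _) (Finset.mem_univ p)]
  congr 1
  · refine Finset.prod_congr rfl (fun i hi => ?_)
    simp [mrgN, mrgR, Finset.ne_of_mem_erase hi]
  · simp [mrgN, mrgR]

lemma coneG_ibp {m : ℕ} (n : Fin (m + 1) → ℕ) {ρ : Fin (m + 1) → ℝ} (hρ : ∀ j, 0 < ρ j)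
    (j : Fin (m + 1)) :
    (n j + 1) * coneG n ρ - ρ j * coneG (bump n j) ρ =
      (if h : (j : ℕ) < m then coneG (mrgN n j ⟨j, h⟩) (mrgR ρ j ⟨j, h⟩) else 0) -
      (if h : 0 < (j : ℕ) then coneG (mrgN n j ⟨j - 1, by omega⟩) (mrgR ρ j ⟨j - 1, by omega⟩)
        else 0) := by
  set A : (Fin m → ℝ) → ℝ := fun t => ∏ i, kerW (n (j.succAbove i)) (ρ (j.succAbove i)) (t i) with hA
  set f : (Fin (m + 1) → ℝ) → ℝ := fun t => {t | Monotone t}.indicator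
    (fun t => A (fun i => t (j.succAbove i)) * kerD (n j) (ρ j) (t j)) t with hf
  have hpw : ∀ t : Fin (m + 1) → ℝ, A (fun i => t (j.succAbove i)) * kerD (n j) (ρ j) (t j) =
      (n j + 1) * ∏ i, kerW (n i) (ρ i) (t i) - ρ j * ∏ i, kerW (bump n j i) (ρ i) (t i) := by
    intro t
    rw [Fin.prod_univ_succAbove _ j, Fin.prod_univ_succAbove _ j]
    have : ∀ i, bump n j (j.succAbove i) = n (j.succAbove i) := fun i => by
      simp [bump, Fin.succAbove_ne]
    simp only [this, kerD, hA]
    simp only [bump, Function.update_self]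
    ring
  have hi1 := ((prodW_integrable n hρ).const_mul (n j + 1 : ℝ))
  have hi2 := ((prodW_integrable (bump n j) hρ).const_mul (ρ j))
  have hlhs : (n j + 1) * coneG n ρ - ρ j * coneG (bump n j) ρ = ∫ t, f t := by
    simp only [hf]
    rw [integral_indicator (measurableSet_mono _)]
    simp_rw [hpw]
    rw [integral_sub hi1.restrict hi2.restrict, integral_const_mul, integral_const_mul]
    rfl
  have hfi : Integrable f := by
    simp only [hf]
    simp_rw [hpw]
    exact (hi1.sub hi2).indicator (measurableSet_mono _)
  have mp := (volume_preserving_piFinSuccAbove (fun _ : Fin (m + 1) => ℝ) j).symm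
  have hfi2 : Integrable (fun p : ℝ × (Fin m → ℝ) => f (j.insertNth p.1 p.2))
      (volume.prod volume) := mp.integrable_comp_of_integrable hfi
  have hval : ∀ t : Fin m → ℝ, ∫ x, f (j.insertNth x t) = {t | Monotone t}.indicator (fun t =>
      A t * ((if h : (j : ℕ) < m then kerW (n j + 1) (ρ j) (t ⟨j, h⟩) else 0) -
      (if h : 0 < (j : ℕ) then kerW (n j + 1) (ρ j) (t ⟨j - 1, by omega⟩) else 0))) t := by
    intro t
    have hfe : ∀ x, f (j.insertNth x t) = A t *
        {x : ℝ | Monotone (j.insertNth x t : Fin (m + 1) → ℝ)}.indicator (kerD (n j) (ρ j)) x := by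
      intro x
      simp only [hf, Set.indicator, Set.mem_ofPred_eq, Fin.insertNth_apply_succAbove,
        Fin.insertNth_apply_same]
      split_ifs <;> simp
    simp_rw [hfe]
    rw [integral_const_mul]
    by_cases ht : Monotone t
    · rw [Set.indicator_of_mem (show t ∈ {t | Monotone t} from ht)]
      by_cases ht0 : ∀ i, 0 ≤ t i
      · rw [inner_integral j (n j) (hρ j) t ht ht0]
      · push Not at ht0
        obtain ⟨i, hi⟩ := ht0
        have : A t = 0 := Finset.prod_eq_zero (Finset.mem_univ i) (by simp [kerW, not_le.2 hi])
        rw [this, zero_mul, zero_mul]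
    · rw [Set.indicator_of_notMem (show t ∉ {t | Monotone t} from ht)]
      have : {x : ℝ | Monotone (j.insertNth x t : Fin (m + 1) → ℝ)} = ∅ := by
        ext x; simp only [Set.mem_ofPred_eq, Set.mem_empty_iff_false, iff_false]
        exact fun h => ht ((mono_insertNth_iff j x t).1 h).1
      rw [this]; simp
  have hmpos : ∀ p i, 0 < mrgR ρ j p i := fun p i => by
    unfold mrgR
    split_ifs
    · exact add_pos (hρ _) (hρ _)
    · simpa using hρ _
  rw [hlhs, ← mp.integral_comp' f]
  change ∫ p : ℝ × (Fin m → ℝ), f (j.insertNth p.1 p.2) ∂(volume.prod volume) = _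
  rw [integral_prod_symm _ hfi2]
  simp_rw [hval]
  rw [integral_indicator (measurableSet_mono _)]
  simp_rw [mul_sub]
  have hU : ∀ p, Integrable (fun t : Fin m → ℝ => A t * kerW (n j + 1) (ρ j) (t p)) := fun p => by
    simp only [hA, prod_mrg]
    exact prodW_integrable _ (hmpos p)
  have hcone : ∀ p, ∫ t in {t | Monotone t}, A t * kerW (n j + 1) (ρ j) (t p) =
      coneG (mrgN n j p) (mrgR ρ j p) := fun p => by
    simp only [hA, prod_mrg]; rfl
  rw [integral_sub]
  · congr 1
    · split_ifs with h
      · exact hcone _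
      · simp
    · split_ifs with h
      · exact hcone _
      · simp
  · split_ifs with h
    · exact (hU _).restrict
    · simp
  · split_ifs with h
    · exact (hU _).restrict
    · simp

/-- determinant of a family of vectors, with respect to an enumeration of the coordinates -/
noncomputable def dt {ι V : Type*} [Fintype ι] [DecidableEq ι] (e : ι ≃ V) (w : ι → V → ℝ) : ℝ :=
  Matrix.det (Matrix.of fun (r c : ι) => w c (e r))

lemma dt_update_sum {ι V : Type*} [Fintype ι] [DecidableEq ι] [Fintype V]
    (e : ι ≃ V) (w : ι → V → ℝ) (T : Matrix V V ℝ) :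
    ∑ c, dt e (Function.update w c (T.mulVec (w c))) = T.trace * dt e w := by
  classical
  set M : Matrix ι ι ℝ := Matrix.of fun (r c : ι) => w c (e r) with hM
  set T' : Matrix ι ι ℝ := T.submatrix e e with hT'
  have h1 : ∀ c, dt e (Function.update w c (T.mulVec (w c))) = (M.adjugate * (T' * M)) c c := by
    intro c
    have h2 : (Matrix.of fun (r c' : ι) => Function.update w c (T.mulVec (w c)) c' (e r)) =
        M.updateCol c (fun r => (T' * M) r c) := by
      ext r c'
      by_cases h : c' = c
      · subst h
        simp only [Matrix.of_apply, Function.update_self, Matrix.updateCol_self]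
        rw [Matrix.mul_apply, Matrix.mulVec, dotProduct]
        rw [← e.sum_comp]
        rfl
      · simp [h, hM]
    rw [dt, h2, ← Matrix.cramer_apply, Matrix.cramer_eq_adjugate_mulVec]
    rfl
  simp_rw [h1]
  change (M.adjugate * (T' * M)).trace = _
  rw [Matrix.trace_mul_comm, Matrix.mul_assoc, Matrix.mul_adjugate]
  rw [Matrix.mul_smul, Matrix.mul_one, Matrix.trace_smul, smul_eq_mul, mul_comm]
  congr 1
  rw [Matrix.trace, Matrix.trace, ← e.sum_comp]
  rfl

lemma dt_perm {ι V : Type*} [Fintype ι] [DecidableEq ι] (e : ι ≃ V) (w : ι → V → ℝ)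
    (σ : Equiv.Perm ι) : dt e (fun c => w (σ c)) = ((Equiv.Perm.sign σ : ℤ) : ℝ) * dt e w := by
  have := Matrix.det_permute' σ (Matrix.of fun (r c : ι) => w c (e r))
  exact this

lemma dt_perm_row {ι V : Type*} [Fintype ι] [DecidableEq ι] (e : ι ≃ V) (w : ι → V → ℝ)
    (σ : Equiv.Perm ι) : dt (σ.trans e) w = ((Equiv.Perm.sign σ : ℤ) : ℝ) * dt e w := by
  have := Matrix.det_permute σ (Matrix.of fun (r c : ι) => w c (e r))
  exact this

lemma dt_reindex {ι κ V : Type*} [Fintype ι] [DecidableEq ι] [Fintype κ] [DecidableEq κ]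
    (e : ι ≃ V) (τ : κ ≃ ι) (w : ι → V → ℝ) :
    dt (τ.trans e) (fun c => w (τ c)) = dt e w := by
  have := Matrix.det_submatrix_equiv_self τ (Matrix.of fun (r c : ι) => w c (e r))
  exact this

/-- the equivalence shifting one slot from the right block to the left block -/
def shiftEquiv (m k : ℕ) : (Fin m ⊕ Fin (k + 1)) ≃ (Fin (m + 1) ⊕ Fin k) where
  toFun := Sum.elim (fun p => Sum.inl p.succ) (Fin.cases (Sum.inl 0) (fun p => Sum.inr p))
  invFun := Sum.elim (Fin.cases (Sum.inr 0) (fun p => Sum.inl p)) (fun p => Sum.inr p.succ)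
  left_inv := by
    rintro (p | p)
    · simp
    · induction p using Fin.cases <;> simp
  right_inv := by
    rintro (p | p)
    · induction p using Fin.cases <;> simp
    · simp

lemma dt_shift {V : Type*} (m k : ℕ) (e : (Fin (m + 1) ⊕ Fin k) ≃ V)
    (e' : (Fin m ⊕ Fin (k + 1)) ≃ V) :
    ∃ c : ℝ, (c = 1 ∨ c = -1) ∧ ∀ (u : V → ℝ) (A : Fin m → V → ℝ) (B : Fin k → V → ℝ),
      dt e (Sum.elim (Fin.cons u A : Fin (m + 1) → V → ℝ) B) =
        c * dt e' (Sum.elim A (Fin.cons u B : Fin (k + 1) → V → ℝ)) := by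
  set σ : Equiv.Perm (Fin m ⊕ Fin (k + 1)) := ((shiftEquiv m k).trans e).trans e'.symm with hσ
  refine ⟨((Equiv.Perm.sign σ : ℤ) : ℝ), ?_, fun u A B => ?_⟩
  · rcases Int.units_eq_one_or (Equiv.Perm.sign σ) with h | h <;> simp [h]
  · rw [← dt_perm_row, ← dt_reindex e (shiftEquiv m k)]
    have h1 : (σ.trans e') = (shiftEquiv m k).trans e := by
      ext x; simp [hσ]
    rw [h1]
    congr 1
    ext c i
    rcases c with p | p
    · simp [shiftEquiv]
    · induction p using Fin.cases <;> simp [shiftEquiv]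

lemma dt_move {V : Type*} {m k : ℕ} (e : (Fin (m + 1) ⊕ Fin k) ≃ V)
    (e' : (Fin m ⊕ Fin (k + 1)) ≃ V) {c : ℝ}
    (hc : ∀ (u : V → ℝ) (A : Fin m → V → ℝ) (B : Fin k → V → ℝ),
      dt e (Sum.elim (Fin.cons u A : Fin (m + 1) → V → ℝ) B) =
        c * dt e' (Sum.elim A (Fin.cons u B : Fin (k + 1) → V → ℝ)))
    (j : Fin (m + 1)) (l : Fin (k + 1)) (u : V → ℝ) (X : Fin (m + 1) → V → ℝ)
    (v : Fin (k + 1) → V → ℝ) :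
    (-1 : ℝ) ^ (l : ℕ) * dt e (Sum.elim (Function.update X j u) (fun p => v (l.succAbove p))) =
      c * (-1) ^ (j : ℕ) *
        dt e' (Sum.elim (fun p => X (j.succAbove p)) (Function.update v l u)) := by
  have h1 := dt_perm e (Sum.elim (Function.update X j u) (fun p => v (l.succAbove p)))
    (Equiv.sumCongr j.cycleRange.symm (Equiv.refl _))
  have h2 := dt_perm e' (Sum.elim (fun p => X (j.succAbove p)) (Function.update v l u))
    (Equiv.sumCongr (Equiv.refl _) l.cycleRange.symm)
  have e1 : (fun c => (Sum.elim (Function.update X j u) (fun p => v (l.succAbove p)) :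
        Fin (m + 1) ⊕ Fin k → V → ℝ)
      ((Equiv.sumCongr j.cycleRange.symm (Equiv.refl _)) c)) =
      Sum.elim (Fin.cons u (fun p => X (j.succAbove p)) : Fin (m + 1) → V → ℝ)
        (fun p => v (l.succAbove p)) := by
    ext c i
    rcases c with p | p
    · induction p using Fin.cases <;> simp [Fin.cycleRange_symm_zero, Fin.cycleRange_symm_succ]
    · simp
  have e2 : (fun c => (Sum.elim (fun p => X (j.succAbove p)) (Function.update v l u) :
        Fin m ⊕ Fin (k + 1) → V → ℝ)
      ((Equiv.sumCongr (Equiv.refl _) l.cycleRange.symm) c)) =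
      Sum.elim (fun p => X (j.succAbove p))
        (Fin.cons u (fun p => v (l.succAbove p)) : Fin (k + 1) → V → ℝ) := by
    ext c i
    rcases c with p | p
    · simp
    · induction p using Fin.cases <;> simp [Fin.cycleRange_symm_zero, Fin.cycleRange_symm_succ]
  rw [e1] at h1
  rw [e2] at h2
  rw [Equiv.Perm.sign_sumCongr, Equiv.Perm.sign_symm, Fin.sign_cycleRange] at h1
  rw [Equiv.Perm.sign_sumCongr, Equiv.Perm.sign_symm, Fin.sign_cycleRange] at h2
  rw [hc, h2] at h1
  simp only [Equiv.Perm.sign_refl, one_mul, mul_one, Units.val_pow_eq_pow_val, Units.val_neg,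
    Units.val_one, Int.cast_pow, Int.cast_neg, Int.cast_one] at h1
  have hj : ((-1 : ℝ) ^ (j : ℕ)) * (-1) ^ (j : ℕ) = 1 := by rw [← mul_pow]; simp
  have hl : ((-1 : ℝ) ^ (l : ℕ)) * (-1) ^ (l : ℕ) = 1 := by rw [← mul_pow]; simp
  set D := dt e (Sum.elim (Function.update X j u) (fun p => v (l.succAbove p)))
  set D' := dt e' (Sum.elim (fun p => X (j.succAbove p)) (Function.update v l u))
  linear_combination (-(-1 : ℝ) ^ (l : ℕ) * (-1) ^ (j : ℕ)) * h1 - (-1 : ℝ) ^ (l : ℕ) * D * hj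
    + c * (-1) ^ (j : ℕ) * D' * hl

/-- the key linear algebra identity -/
lemma dt_key {V : Type*} [Fintype V] {m k : ℕ} (e : (Fin (m + 1) ⊕ Fin k) ≃ V)
    (e' : (Fin m ⊕ Fin (k + 1)) ≃ V) {c : ℝ}
    (hc : ∀ (u : V → ℝ) (A : Fin m → V → ℝ) (B : Fin k → V → ℝ),
      dt e (Sum.elim (Fin.cons u A : Fin (m + 1) → V → ℝ) B) =
        c * dt e' (Sum.elim A (Fin.cons u B : Fin (k + 1) → V → ℝ)))
    (j : Fin (m + 1)) (X : Fin (m + 1) → V → ℝ) (v : Fin (k + 1) → V → ℝ) (T : Matrix V V ℝ)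
    (hT : ∀ i, i ≠ j → T.mulVec (X i) = 0) :
    ∑ l : Fin (k + 1), (-1 : ℝ) ^ (l : ℕ) *
        dt e (Sum.elim (Function.update X j (T.mulVec (v l))) (fun p => v (l.succAbove p))) =
      c * (-1) ^ (j : ℕ) * (T.trace * dt e' (Sum.elim (fun p => X (j.succAbove p)) v)) := by
  simp_rw [dt_move e e' hc]
  rw [← dt_update_sum, ← Finset.mul_sum, Fintype.sum_sum_type]
  congr 1
  have hz : ∀ p : Fin m, dt e' (Function.update (Sum.elim (fun p => X (j.succAbove p)) v)
      (Sum.inl p) (T.mulVec ((Sum.elim (fun p => X (j.succAbove p)) v :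
        Fin m ⊕ Fin (k + 1) → V → ℝ) (Sum.inl p)))) = 0 := by
    intro p
    refine Matrix.det_eq_zero_of_column_eq_zero (Sum.inl p) (fun r => ?_)
    rw [Matrix.of_apply, Function.update_self, Sum.elim_inl, hT _ (Fin.succAbove_ne j p)]
    rfl
  rw [Finset.sum_eq_zero (fun p _ => hz p), zero_add]
  refine Finset.sum_congr rfl (fun l _ => ?_)
  congr 1
  rw [Sum.update_elim_inr, Sum.elim_inr]

/-- `dt e` as a multilinear map -/
noncomputable def dtM {ι V : Type*} [Fintype ι] [DecidableEq ι] (e : ι ≃ V) :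
    MultilinearMap ℝ (fun _ : ι => V → ℝ) ℝ :=
  (Matrix.detRowAlternating (n := ι) (R := ℝ)).toMultilinearMap.compLinearMap
    (fun _ => LinearMap.funLeft ℝ ℝ e)

lemma dtM_apply {ι V : Type*} [Fintype ι] [DecidableEq ι] (e : ι ≃ V) (w : ι → V → ℝ) :
    dtM e w = dt e w := by
  rw [dt, ← Matrix.det_transpose]
  rfl

lemma dt_add {ι V : Type*} [Fintype ι] [DecidableEq ι] (e : ι ≃ V) (w : ι → V → ℝ) (i : ι)
    (x y : V → ℝ) : dt e (Function.update w i (x + y)) =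
      dt e (Function.update w i x) + dt e (Function.update w i y) := by
  simp only [← dtM_apply, MultilinearMap.map_update_add]

lemma dt_smul {ι V : Type*} [Fintype ι] [DecidableEq ι] (e : ι ≃ V) (w : ι → V → ℝ) (i : ι)
    (a : ℝ) (x : V → ℝ) : dt e (Function.update w i (a • x)) =
      a * dt e (Function.update w i x) := by
  simp only [← dtM_apply, MultilinearMap.map_update_smul, smul_eq_mul]

lemma dt_zero {ι V : Type*} [Fintype ι] [DecidableEq ι] (e : ι ≃ V) (w : ι → V → ℝ) (i : ι) :
    dt e (Function.update w i 0) = 0 := by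
  simp only [← dtM_apply, MultilinearMap.map_update_zero]

lemma dtM_continuous {ι V : Type*} [Fintype ι] [DecidableEq ι] [Fintype V] (e : ι ≃ V) :
    Continuous (dtM e) := by
  have : (dtM e : (ι → V → ℝ) → ℝ) = dt e := funext (dtM_apply e)
  rw [this]
  unfold dt
  refine Continuous.matrix_det ?_
  refine continuous_matrix (fun i j => ?_)
  simp only [Matrix.of_apply]
  fun_prop

/-- coordinates vectors `X_j` -/
def Xv {V : Type*} {q : ℕ} (idx : V → Fin q) (l : V → ℝ) : Fin q → V → ℝ :=
  fun j i => if idx i = j then l i else 0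

lemma dt_hasFDerivAt {V : Type*} [Fintype V] {q k : ℕ} (idx : V → Fin q)
    (e : (Fin q ⊕ Fin k) ≃ V) (v : Fin k → V → ℝ) (l : V → ℝ) :
    ∃ L : (V → ℝ) →L[ℝ] ℝ, HasFDerivAt (fun l' => dt e (Sum.elim (Xv idx l') v)) L l ∧
      ∀ u, L u = ∑ j, dt e (Sum.elim (Function.update (Xv idx l) j (Xv idx u j)) v) := by
  let f : ContinuousMultilinearMap ℝ (fun _ : Fin q ⊕ Fin k => V → ℝ) ℝ := ⟨dtM e, dtM_continuous e⟩
  let Pl : (V → ℝ) →ₗ[ℝ] (Fin q ⊕ Fin k → V → ℝ) :=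
    { toFun := fun u => Sum.elim (Xv idx u) 0
      map_add' := fun a b => by
        ext c i; rcases c with c | c <;> simp [Xv]; split_ifs <;> simp
      map_smul' := fun a b => by
        ext c i; rcases c with c | c <;> simp [Xv] }
  let P : (V → ℝ) →L[ℝ] (Fin q ⊕ Fin k → V → ℝ) := ⟨Pl, Pl.continuous_of_finiteDimensional⟩
  have hP : HasFDerivAt (fun l' : V → ℝ => (Sum.elim (Xv idx l') v : Fin q ⊕ Fin k → V → ℝ)) P l := by
    have h := P.hasFDerivAt (x := l) |>.add_const (Sum.elim 0 v : Fin q ⊕ Fin k → V → ℝ)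
    refine h.congr_of_eventuallyEq (Filter.Eventually.of_forall fun l' => ?_)
    ext c i
    rcases c with c | c <;> simp [P, Pl]
  have h := (f.hasFDerivAt (Sum.elim (Xv idx l) v)).comp l hP
  refine ⟨_, h.congr_of_eventuallyEq (Filter.Eventually.of_forall fun l' => ?_), fun u => ?_⟩
  · exact (dtM_apply e _).symm
  · rw [ContinuousLinearMap.comp_apply, ContinuousMultilinearMap.linearDeriv_apply,
      Fintype.sum_sum_type]
    have h2 : ∀ w, f w = dt e w := fun w => dtM_apply e w
    simp only [h2]
    have h3 : ∀ p : Fin k, dt e (Function.update (Sum.elim (Xv idx l) v) (Sum.inr p) (P u (Sum.inr p)))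
      = 0 := fun p => dt_zero e _ _
    rw [Finset.sum_eq_zero (s := (Finset.univ : Finset (Fin k))) (fun p _ => h3 p), add_zero]
    refine Finset.sum_congr rfl (fun j _ => ?_)
    rw [Sum.update_elim_inl]
    rfl

/-- sizes of the parts -/
def partN {V : Type*} [Fintype V] {q : ℕ} (idx : V → Fin q) (j : Fin q) : ℕ :=
  (Finset.univ.filter (fun i => idx i = j)).card

/-- rates of the parts -/
noncomputable def partR {V : Type*} [Fintype V] {q : ℕ} (idx : V → Fin q) (l : V → ℝ)
    (j : Fin q) : ℝ := ∑ i ∈ Finset.univ.filter (fun i => idx i = j), l i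

lemma partN_pos {V : Type*} [Fintype V] {q : ℕ} {idx : V → Fin q} (h : Function.Surjective idx)
    (j : Fin q) : 1 ≤ partN idx j := by
  obtain ⟨x, hx⟩ := h j
  exact Finset.card_pos.2 ⟨x, by simp [hx]⟩

lemma partR_pos {V : Type*} [Fintype V] {q : ℕ} {idx : V → Fin q} (h : Function.Surjective idx)
    {l : V → ℝ} (hl : ∀ i, 0 < l i) (j : Fin q) : 0 < partR idx l j := by
  obtain ⟨x, hx⟩ := h j
  exact Finset.sum_pos (fun i _ => hl i) ⟨x, by simp [hx]⟩

lemma psiGen_eq {V : Type*} [Fintype V] [DecidableEq V] {q k : ℕ}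
    {idx : V → Fin q} (h : Function.Surjective idx) (e : (Fin q ⊕ Fin k) ≃ V) {l : V → ℝ}
    (hl : ∀ i, 0 < l i) (v : Fin k → V → ℝ) :
    psiGen q k idx e l v =
      coneG (fun j => partN idx j - 1) (partR idx l) * dt e (Sum.elim (Xv idx l) v) := by
  rw [← prob_eq (partN idx) (partN_pos h) (partR idx l) (partR_pos h hl)]
  rfl

lemma mergeMap_iff {m : ℕ} (p : Fin m) (j : Fin (m + 1)) (hj : j = p.castSucc ∨ j = p.succ)
    (a : Fin (m + 1)) (i : Fin m) :
    mergeMap m p a = i ↔ (a = j.succAbove i ∨ (i = p ∧ a = j)) := by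
  unfold mergeMap Fin.succAbove
  rcases hj with rfl | rfl <;> split_ifs with h1 h2 h2 <;>
    simp only [Fin.ext_iff, Fin.lt_def, Fin.val_castSucc, Fin.val_succ] at * <;> omega

lemma sum_merge {V : Type*} [Fintype V] {M : Type*} [AddCommMonoid M] {m : ℕ}
    (idx : V → Fin (m + 1)) (p : Fin m) (j : Fin (m + 1)) (hj : j = p.castSucc ∨ j = p.succ)
    (f : V → M) (i : Fin m) :
    ∑ x ∈ Finset.univ.filter (fun x => mergeMap m p (idx x) = i), f x =
      ∑ x ∈ Finset.univ.filter (fun x => idx x = j.succAbove i), f x +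
        if i = p then ∑ x ∈ Finset.univ.filter (fun x => idx x = j), f x else 0 := by
  classical
  simp only [mergeMap_iff p j hj]
  rw [Finset.filter_or, Finset.sum_union]
  · congr 1
    by_cases h : i = p <;> simp [h]
  · rw [Finset.disjoint_filter]
    rintro x - hx ⟨_, hx2⟩
    exact Fin.succAbove_ne j i (hx.symm.trans hx2)

lemma partR_merge {V : Type*} [Fintype V] {m : ℕ} (idx : V → Fin (m + 1)) (l : V → ℝ)
    (p : Fin m) (j : Fin (m + 1)) (hj : j = p.castSucc ∨ j = p.succ) :
    mrgR (partR idx l) j p = partR (fun x => mergeMap m p (idx x)) l := by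
  ext i
  exact (sum_merge idx p j hj l i).symm

lemma partN_merge {V : Type*} [Fintype V] {m : ℕ} {idx : V → Fin (m + 1)}
    (hs : Function.Surjective idx)
    (p : Fin m) (j : Fin (m + 1)) (hj : j = p.castSucc ∨ j = p.succ) :
    mrgN (fun j => partN idx j - 1) j p = fun i => partN (fun x => mergeMap m p (idx x)) i - 1 := by
  ext i
  have h := sum_merge idx p j hj (fun _ => 1) i
  simp only [← Finset.card_eq_sum_ones] at h
  change partN (fun x => mergeMap m p (idx x)) i = partN idx _ + (if i = p then partN idx j else 0)
    at h
  have h1 := partN_pos hs (j.succAbove i)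
  have h2 := partN_pos hs j
  simp only [mrgN]
  split_ifs at h ⊢ <;> omega

lemma mergeMap_surj {V : Type*} {m : ℕ} {idx : V → Fin (m + 1)}
    (hs : Function.Surjective idx) (p : Fin m) :
    Function.Surjective (fun x => mergeMap m p (idx x)) := by
  intro i
  obtain ⟨x, hx⟩ := hs (p.castSucc.succAbove i)
  exact ⟨x, (mergeMap_iff p _ (Or.inl rfl) _ _).2 (Or.inl hx)⟩

lemma Xv_merge {V : Type*} {m : ℕ} (idx : V → Fin (m + 1)) (l : V → ℝ)
    (p : Fin m) (j : Fin (m + 1)) (hj : j = p.castSucc ∨ j = p.succ) :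
    Xv (fun x => mergeMap m p (idx x)) l =
      Function.update (fun i => Xv idx l (j.succAbove i)) p
        (Xv idx l (j.succAbove p) + Xv idx l j) := by
  ext i x
  by_cases h : i = p
  · subst h
    simp only [Xv, Function.update_self, Pi.add_apply, mergeMap_iff i j hj]
    by_cases h1 : idx x = j.succAbove i
    · simp [h1, Fin.succAbove_ne]
    · simp [h1]
  · simp only [Xv, Function.update_of_ne h, mergeMap_iff p j hj]
    simp [h]

lemma dt_merge {V : Type*} {m k : ℕ} (e' : (Fin m ⊕ Fin k) ≃ V)
    (idx : V → Fin (m + 1)) (l : V → ℝ) (v : Fin k → V → ℝ) (p : Fin m) :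
    dt e' (Sum.elim (Xv (fun x => mergeMap m p (idx x)) l) v) =
      dt e' (Sum.elim (fun i => Xv idx l (p.castSucc.succAbove i)) v) +
      dt e' (Sum.elim (fun i => Xv idx l (p.succ.succAbove i)) v) := by
  rw [Xv_merge idx l p p.castSucc (Or.inl rfl), ← Sum.update_elim_inl, dt_add,
    Sum.update_elim_inl, Sum.update_elim_inl, Function.update_eq_self]
  congr 3
  ext i x
  by_cases h : i = p
  · subst h
    simp
  · rw [Function.update_of_ne h]
    congr 1
    unfold Fin.succAbove
    split_ifs with h1 h2 h2 <;> 
      simp only [Fin.ext_iff, Fin.lt_def, Fin.val_castSucc, Fin.val_succ] at * <;> omega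

/-- the operator `G P_j + g X_j ⊗ s_j` -/
noncomputable def Tj {V : Type*} [DecidableEq V] {q : ℕ} (idx : V → Fin q) (l : V → ℝ) (a b : ℝ)
    (j : Fin q) : Matrix V V ℝ :=
  a • Matrix.diagonal (fun x => if idx x = j then 1 else 0) +
    b • Matrix.vecMulVec (Xv idx l j) (fun x => if idx x = j then 1 else 0)

lemma Tj_mulVec {V : Type*} [Fintype V] [DecidableEq V] {q : ℕ} (idx : V → Fin q) (l : V → ℝ)
    (a b : ℝ) (j : Fin q) (u : V → ℝ) :
    (Tj idx l a b j).mulVec u = a • Xv idx u j + (b * partR idx u j) • Xv idx l j := by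
  rw [Tj, Matrix.add_mulVec, Matrix.smul_mulVec, Matrix.smul_mulVec]
  congr 1
  · congr 1
    ext x
    rw [Matrix.mulVec_diagonal]
    simp [Xv]
  · rw [mul_smul]
    congr 1
    ext x
    rw [Matrix.vecMulVec_mulVec]
    simp [partR, dotProduct, Finset.sum_filter, mul_comm]

lemma Tj_trace {V : Type*} [Fintype V] [DecidableEq V] {q : ℕ} (idx : V → Fin q) (l : V → ℝ)
    (a b : ℝ) (j : Fin q) :
    (Tj idx l a b j).trace = a * partN idx j + b * partR idx l j := by
  rw [Tj, Matrix.trace_add, Matrix.trace_smul, Matrix.trace_smul, Matrix.trace_diagonal,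
    Matrix.trace_vecMulVec]
  congr 1
  · simp [partN]
  · rw [smul_eq_mul]
    congr 1
    simp only [partR, dotProduct, Finset.sum_filter, Xv]
    refine Finset.sum_congr rfl (fun x _ => ?_)
    split_ifs <;> simp

lemma Tj_zero {V : Type*} [Fintype V] [DecidableEq V] {q : ℕ} (idx : V → Fin q) (l : V → ℝ)
    (a b : ℝ) (j i : Fin q) (h : i ≠ j) : (Tj idx l a b j).mulVec (Xv idx l i) = 0 := by
  rw [Tj_mulVec]
  have h1 : Xv idx (Xv idx l i) j = 0 := by
    ext x
    simp only [Xv, Pi.zero_apply]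
    split_ifs with h1 h2
    · exact absurd (h2.symm.trans h1) h
    · rfl
    · rfl
  have h2 : partR idx (Xv idx l i) j = 0 := by
    refine Finset.sum_eq_zero (fun x hx => ?_)
    simp only [Finset.mem_filter, Finset.mem_univ, true_and] at hx
    simp only [Xv]
    rw [if_neg]
    rintro rfl
    exact h hx
  simp [h1, h2]

lemma psi_hasFDerivAt {V : Type*} [Fintype V] [DecidableEq V] {q k : ℕ}
    {idx : V → Fin q} (h : Function.Surjective idx) (e : (Fin q ⊕ Fin k) ≃ V) {l : V → ℝ}
    (hl : ∀ i, 0 < l i) (v : Fin k → V → ℝ) :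
    ∃ L : (V → ℝ) →L[ℝ] ℝ, HasFDerivAt (fun l' => psiGen q k idx e l' v) L l ∧
      ∀ u, L u = ∑ j, dt e (Sum.elim (Function.update (Xv idx l) j
        ((Tj idx l (coneG (fun j => partN idx j - 1) (partR idx l))
          (-coneG (bump (fun j => partN idx j - 1) j) (partR idx l)) j).mulVec u)) v) := by
  obtain ⟨L, hL, hLu⟩ := dt_hasFDerivAt idx e v l
  let Rl : (V → ℝ) →ₗ[ℝ] (Fin q → ℝ) :=
    { toFun := partR idx
      map_add' := fun a b => by ext j; simp [partR, Finset.sum_add_distrib]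
      map_smul' := fun a b => by ext j; simp [partR, Finset.mul_sum] }
  let R : (V → ℝ) →L[ℝ] (Fin q → ℝ) := ⟨Rl, Rl.continuous_of_finiteDimensional⟩
  have h1 := (coneG_hasFDerivAt (fun j => partN idx j - 1) (partR_pos h hl)).comp l
    (R.hasFDerivAt (x := l))
  have h2 := h1.mul hL
  have hev : ∀ᶠ l' in nhds l, ∀ i, 0 < l' i := by
    rw [Filter.eventually_all]
    intro i
    exact (continuous_apply i).continuousAt.eventually (lt_mem_nhds (hl i))
  refine ⟨_, h2.congr_of_eventuallyEq (hev.mono fun l' hl' => psiGen_eq h e hl' v), fun u => ?_⟩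
  rw [_root_.add_apply, _root_.smul_apply,
    _root_.smul_apply, hLu, ContinuousLinearMap.comp_apply,
    _root_.sum_apply]
  simp only [smul_eq_mul]
  rw [Finset.mul_sum, Finset.mul_sum, ← Finset.sum_add_distrib]
  refine Finset.sum_congr rfl (fun j _ => ?_)
  rw [Tj_mulVec, ← Sum.update_elim_inl, ← Sum.update_elim_inl, dt_add, dt_smul, dt_smul]
  congr 1
  rw [Sum.update_elim_inl, Function.update_eq_self, mul_comm]
  rfl

/-- For a flag `F` with `m+1` parts on `V` (`|V| = n+1`, `k = n − m`,
`m ≥ 1`), the form `ψ̂_F` is differentiable on the open positive orthant, and there are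
signs `ε_j ∈ {±1}` with `dψ̂_F = ∑_{j} ε_j ψ̂_{F_j}`, where `F_j` merges the consecutive
parts `V_j, V_{j+1}` (`j = 0,…,m−1`), and the exterior derivative is
`(dψ)(λ)(v_0,…,v_k) = ∑_l (−1)^l (Dψ(λ)[v_l])(v_0,…,v̂_l,…,v_k)`. -/
theorem statement14 {V : Type*} [Fintype V] [DecidableEq V] (m k : ℕ) (hm : 1 ≤ m)
    (hcard : Fintype.card V = m + k + 1)
    (idx : V → Fin (m + 1)) (hidx : Function.Surjective idx)
    (e : (Fin (m + 1) ⊕ Fin k) ≃ V) (e' : (Fin m ⊕ Fin (k + 1)) ≃ V) :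
    (∀ l : V → ℝ, (∀ i, 0 < l i) → ∀ v : Fin k → V → ℝ,
      DifferentiableAt ℝ (fun l' => psiGen (m + 1) k idx e l' v) l) ∧
    ∃ ε : Fin m → ℝ, (∀ j, ε j = 1 ∨ ε j = -1) ∧
      ∀ l : V → ℝ, (∀ i, 0 < l i) → ∀ v : Fin (k + 1) → V → ℝ,
        ∑ i : Fin (k + 1), (-1 : ℝ) ^ (i : ℕ) *
            fderiv ℝ (fun l' => psiGen (m + 1) k idx e l'
              (fun p => v (i.succAbove p))) l (v i)
          = ∑ j : Fin m, ε j * psiGen m (k + 1) (fun x => mergeMap m j (idx x)) e' l v := by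
  refine ⟨fun l hl v => ?_, ?_⟩
  · obtain ⟨L, hL, -⟩ := psi_hasFDerivAt hidx e hl v
    exact hL.differentiableAt
  obtain ⟨c, hc1, hc⟩ := dt_shift m k e e'
  refine ⟨fun j => c * (-1) ^ (j : ℕ), fun j => ?_, fun l hl v => ?_⟩
  · rcases hc1 with rfl | rfl <;> rcases neg_one_pow_eq_or ℝ (j : ℕ) with h | h <;> simp [h]
  set G := coneG (fun j => partN idx j - 1) (partR idx l) with hG
  set B := fun j => coneG (bump (fun j => partN idx j - 1) j) (partR idx l) with hB
  set M : Fin m → ℝ := fun p => coneG (fun i => partN (fun x => mergeMap m p (idx x)) i - 1)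
    (partR (fun x => mergeMap m p (idx x)) l) with hM
  set D : Fin (m + 1) → ℝ := fun j => dt e' (Sum.elim (fun p => Xv idx l (j.succAbove p)) v) with hD
  have hlhs : ∀ i : Fin (k + 1), fderiv ℝ (fun l' => psiGen (m + 1) k idx e l'
      (fun p => v (i.succAbove p))) l (v i) = ∑ j, dt e (Sum.elim (Function.update (Xv idx l) j
        ((Tj idx l G (-B j) j).mulVec (v i))) (fun p => v (i.succAbove p))) := by
    intro i
    obtain ⟨L, hL, hLu⟩ := psi_hasFDerivAt hidx e hl (fun p => v (i.succAbove p))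
    rw [hL.fderiv, hLu]
  simp_rw [hlhs, Finset.mul_sum]
  rw [Finset.sum_comm]
  simp_rw [fun j => dt_key e e' hc j (Xv idx l) v (Tj idx l G (-B j) j)
    (fun i hi => Tj_zero idx l _ _ j i hi), Tj_trace]
  have hibp : ∀ j : Fin (m + 1), G * partN idx j + -B j * partR idx l j =
      (if h : (j : ℕ) < m then M ⟨j, h⟩ else 0) -
      (if h : 0 < (j : ℕ) then M ⟨j - 1, by omega⟩ else 0) := by
    intro j
    have h1 := coneG_ibp (fun j => partN idx j - 1) (partR_pos hidx hl) j
    have hN : ((partN idx j - 1 : ℕ) : ℝ) + 1 = partN idx j := by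
      have := partN_pos hidx j
      push_cast [Nat.cast_sub this]
      ring
    rw [hN] at h1
    have hL : G * partN idx j + -B j * partR idx l j = (partN idx j : ℝ) * G - partR idx l j * B j := by
      ring
    rw [hL, h1]
    congr 1
    · split_ifs with h
      · rw [partN_merge hidx _ j (Or.inl rfl), partR_merge idx l _ j (Or.inl rfl)]
      · rfl
    · split_ifs with h
      · have hj : j = Fin.succ ⟨(j : ℕ) - 1, by omega⟩ := by
          ext; simp only [Fin.val_succ]; omega
        rw [partN_merge hidx _ j (Or.inr hj), partR_merge idx l _ j (Or.inr hj)]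
      · rfl
  simp_rw [hibp]
  have hrhs : ∀ j : Fin m, psiGen m (k + 1) (fun x => mergeMap m j (idx x)) e' l v =
      M j * (D j.castSucc + D j.succ) := by
    intro j
    rw [psiGen_eq (mergeMap_surj hidx j) e' hl v, dt_merge]
  simp_rw [hrhs, sub_mul, mul_sub]
  rw [Finset.sum_sub_distrib]
  rw [Fin.sum_univ_castSucc]
  rw [Fin.sum_univ_succ (fun j : Fin (m + 1) => c * (-1) ^ (j : ℕ) *
    ((if h : 0 < (j : ℕ) then M ⟨j - 1, by omega⟩ else 0) *
      dt e' (Sum.elim (fun p => Xv idx l (j.succAbove p)) v)))]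
  rw [dif_neg (show ¬ 0 < ((0 : Fin (m + 1)) : ℕ) by simp), zero_mul, mul_zero, zero_add]
  simp only [Fin.val_castSucc, Fin.is_lt, dif_pos, Fin.val_last, lt_self_iff_false, dif_neg,
    not_false_eq_true, zero_mul, mul_zero, add_zero, Fin.val_succ,
    Nat.succ_pos, Nat.add_sub_cancel, Fin.eta]
  rw [← Finset.sum_sub_distrib]
  refine Finset.sum_congr rfl (fun j _ => ?_)
  simp only [hD, pow_succ]
  ring
end
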